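/- arXiv:2502.08032 — 6 statements merged into one kernel-verified Lean document; each statement's English description precedes it below -/
import Mathlib

section
/- Let I=(A,B,E,L,(π_e)_{e∈E}) be a label cover instance and let t ≥ 3 be a real number. Suppose there is a multilabeling φ of I of cost at most t·(|A|+|B|) that covers at least |E|/t edges of I. Then there exists a labeling ψ of I that covers at least |E|/t^8 edges of I. -/
/-- A multilabeling `(φA, φB)` covers the edge `e` of a label cover instance. -/
def MCovers {A B L : Type*} (π : A × B → Set (L × L)) (φA : A → Set L) (φB : B → Set L)
    (e : A × B) : Prop :=
  ∃ x ∈ φA e.1, ∃ y ∈ φB e.2, (x, y) ∈ π e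

open Classical in
/-- If every edge `e ∈ G` has a label satisfying `R e` in the list `φ (p e)` of its endpoint, and
these lists have at most `s` elements, then a single choice of labels satisfies a `1/s` fraction
of `G`. -/
theorem exists_labeling_card_le {α V L : Type*} [Fintype V] [Fintype L] [Nonempty L]
    (G : Finset α) (p : α → V) (R : α → L → Prop) (φ : V → Set L) (s : ℝ) (hs : 0 ≤ s)
    (hR : ∀ e ∈ G, ∃ x ∈ φ (p e), R e x) (hφ : ∀ e ∈ G, ((φ (p e)).ncard : ℝ) ≤ s) :
    ∃ ψ : V → L, (G.card : ℝ) ≤ s * ({e ∈ G | R e (ψ (p e))} : Finset α).card := by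
  have exists_label : ∀ v : V, ∃ x : L, (({e ∈ G | p e = v} : Finset α).card : ℝ) ≤
      s * ({e ∈ G | p e = v ∧ R e x} : Finset α).card := by
    intro v
    obtain hv | ⟨e, he⟩ := ({e ∈ G | p e = v} : Finset α).eq_empty_or_nonempty
    · refine ⟨Classical.arbitrary L, ?_⟩
      rw [hv]
      simp only [Finset.card_empty, Nat.cast_zero]
      positivity
    · obtain ⟨heG, rfl⟩ := Finset.mem_filter.1 he
      obtain ⟨x₀, hx₀, -⟩ := hR e heG
      obtain ⟨x, -, hx⟩ := (φ (p e)).toFinset.exists_max_image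
        (fun x => ({d ∈ G | p d = p e ∧ R d x} : Finset α).card) ⟨x₀, by simpa using hx₀⟩
      refine ⟨x, ?_⟩
      have hsub : ({d ∈ G | p d = p e} : Finset α) ⊆
          (φ (p e)).toFinset.biUnion fun x => {d ∈ G | p d = p e ∧ R d x} := by
        intro d hd
        obtain ⟨hdG, hd⟩ := Finset.mem_filter.1 hd
        obtain ⟨y, hy, hRy⟩ := hR d hdG
        rw [hd] at hy
        simp only [Finset.mem_biUnion, Set.mem_toFinset, Finset.mem_filter]
        exact ⟨y, hy, hdG, hd, hRy⟩
      have hcard := (Finset.card_le_card hsub).trans (Finset.card_biUnion_le_card_mul _ _ _ hx)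
      rw [← Set.ncard_eq_toFinset_card'] at hcard
      calc _ ≤ ((φ (p e)).ncard : ℝ) * ({d ∈ G | p d = p e ∧ R d x} : Finset α).card := by
            exact_mod_cast hcard
        _ ≤ _ := by gcongr; exact hφ e heG
  choose ψ hψ using exists_label
  refine ⟨ψ, ?_⟩
  rw [Finset.card_eq_sum_card_fiberwise (f := p) (t := Finset.univ) (s := G) (by simp),
    Finset.card_eq_sum_card_fiberwise (f := p) (t := Finset.univ)
      (s := {e ∈ G | R e (ψ (p e))}) (by simp)]
  push_cast
  rw [Finset.mul_sum]
  refine Finset.sum_le_sum fun v _ => (hψ v).trans_eq ?_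
  congr 3
  ext e
  simp only [Finset.mem_filter]
  grind

open Classical in
/-- If every fiber of `p` on `E` has `r` elements, then few edges have an endpoint with more than
`s` labels. -/
theorem mul_card_heavy_le {α V L : Type*} [Fintype V] (E : Finset α) (p : α → V) (φ : V → Set L)
    (s : ℝ) (r : ℕ) (hr : ∀ v, ({e ∈ E | p e = v} : Finset α).card = r) :
    s * ({e ∈ E | s < (φ (p e)).ncard} : Finset α).card ≤ r * (∑ v, (φ v).ncard : ℕ) := by
  rw [Finset.card_eq_sum_card_fiberwise (f := p) (t := Finset.univ)
      (s := {e ∈ E | s < (φ (p e)).ncard}) (by simp)]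
  push_cast
  rw [Finset.mul_sum, Finset.mul_sum]
  refine Finset.sum_le_sum fun v _ => ?_
  rw [Finset.filter_filter]
  by_cases hv : s < (φ v).ncard
  · have heq : ({e ∈ E | s < (φ (p e)).ncard ∧ p e = v} : Finset α) =
        {e ∈ E | p e = v} := by
      ext e
      simp only [Finset.mem_filter]
      grind
    rw [heq, hr v, mul_comm]
    gcongr
  · have heq : ({e ∈ E | s < (φ (p e)).ncard ∧ p e = v} : Finset α) = ∅ := by
      ext e
      simp only [Finset.mem_filter, Finset.notMem_empty]
      grind
    rw [heq]
    simp only [Finset.card_empty, Nat.cast_zero, mul_zero]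
    positivity

/-- Given a label cover instance `I=(A,B,E,L,(π_e))` and a real `t ≥ 3`, if
a multilabeling of cost at most `t·(|A|+|B|)` covers at least `|E|/t` edges, then some
labeling covers at least `|E|/t^8` edges. -/
theorem stmt_3 {A B L : Type*} [Fintype A] [Fintype B] [Fintype L] [Nonempty L]
    (E : Set (A × B)) (π : A × B → Set (L × L))
    -- label cover instance: equal part sizes, regular bipartite graph, nonempty relations
    (hAB : Fintype.card A = Fintype.card B)
    (hreg : ∃ r : ℕ, 1 ≤ r ∧ (∀ a : A, {e ∈ E | e.1 = a}.ncard = r) ∧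
      (∀ b : B, {e ∈ E | e.2 = b}.ncard = r))
    (hπ : ∀ e ∈ E, (π e).Nonempty)
    (t : ℝ) (ht : 3 ≤ t)
    (φA : A → Set L) (φB : B → Set L)
    (hcost : (((∑ a : A, (φA a).ncard) + ∑ b : B, (φB b).ncard : ℕ) : ℝ) ≤
      t * ((Fintype.card A : ℝ) + (Fintype.card B : ℝ)))
    (hcov : (E.ncard : ℝ) / t ≤ ({e ∈ E | MCovers π φA φB e}.ncard : ℝ)) :
    ∃ (ψA : A → L) (ψB : B → L),
      (E.ncard : ℝ) / t ^ 8 ≤ ({e ∈ E | (ψA e.1, ψB e.2) ∈ π e}.ncard : ℝ) := by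
  classical
  obtain ⟨r, -, hrA, hrB⟩ := hreg
  lift E to Finset (A × B) using E.toFinite
  have ncard_sep (P : A × B → Prop) :
      {e ∈ (E : Set (A × B)) | P e}.ncard = ({e ∈ E | P e} : Finset (A × B)).card := by
    rw [← Set.ncard_coe_finset]
    congr 1
    ext e
    simp
  simp only [ncard_sep, Set.ncard_coe_finset] at *
  set s : ℝ := 3 * t ^ 2 with hs
  set G : Finset (A × B) := {e ∈ E | MCovers π φA φB e ∧
    ((φA e.1).ncard : ℝ) ≤ s ∧ ((φB e.2).ncard : ℝ) ≤ s} with hG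
  have hE : (E.card : ℝ) = Fintype.card A * r := by
    have h := Finset.card_eq_sum_card_fiberwise (f := Prod.fst) (t := Finset.univ) (s := E)
      (by simp)
    simp only [hrA, Finset.sum_const, Finset.card_univ, smul_eq_mul] at h
    exact_mod_cast h
  have hheavyA := mul_card_heavy_le E Prod.fst φA s r hrA
  have hheavyB := mul_card_heavy_le E Prod.snd φB s r hrB
  have hsplit : (({e ∈ E | MCovers π φA φB e} : Finset (A × B)).card : ℝ) ≤ G.card +
      ({e ∈ E | s < (φA e.1).ncard} : Finset (A × B)).card +
      ({e ∈ E | s < (φB e.2).ncard} : Finset (A × B)).card := by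
    have hsub : ({e ∈ E | MCovers π φA φB e} : Finset (A × B)) ⊆
        (G ∪ {e ∈ E | s < (φA e.1).ncard}) ∪ {e ∈ E | s < (φB e.2).ncard} := by
      intro e he
      simp only [hG, Finset.mem_union, Finset.mem_filter] at he ⊢
      grind
    have h₁ := Finset.card_le_card hsub
    have h₂ := Finset.card_union_le (G ∪ {e ∈ E | s < (φA e.1).ncard})
      {e ∈ E | s < (φB e.2).ncard}
    have h₃ := Finset.card_union_le G {e ∈ E | s < (φA e.1).ncard}
    exact_mod_cast (by omega)
  have hs0 : 0 ≤ s := by positivity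
  have hGcov : ∀ e ∈ G, ∃ x ∈ φA e.1, ∃ y ∈ φB e.2, (x, y) ∈ π e := fun e he =>
    (Finset.mem_filter.1 he).2.1
  obtain ⟨ψA, hψA⟩ := exists_labeling_card_le G Prod.fst
    (fun e x => ∃ y ∈ φB e.2, (x, y) ∈ π e) φA s hs0 hGcov
    fun e he => (Finset.mem_filter.1 he).2.2.1
  obtain ⟨ψB, hψB⟩ := exists_labeling_card_le
    ({e ∈ G | ∃ y ∈ φB e.2, (ψA e.1, y) ∈ π e} : Finset (A × B)) Prod.snd
    (fun e y => (ψA e.1, y) ∈ π e) φB s hs0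
    (fun e he => (Finset.mem_filter.1 he).2)
    fun e he => (Finset.mem_filter.1 (Finset.mem_filter.1 he).1).2.2.2
  refine ⟨ψA, ψB, ?_⟩
  have hfinal : (({e ∈ ({e ∈ G | ∃ y ∈ φB e.2, (ψA e.1, y) ∈ π e} : Finset (A × B)) |
      (ψA e.1, ψB e.2) ∈ π e} : Finset (A × B)).card : ℝ) ≤
      ({e ∈ E | (ψA e.1, ψB e.2) ∈ π e} : Finset (A × B)).card := by
    refine Nat.cast_le.2 (Finset.card_le_card fun e he => ?_)
    simp only [hG, Finset.mem_filter] at he ⊢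
    exact ⟨he.1.1.1, he.2⟩
  set N : ℝ := (({e ∈ E | (ψA e.1, ψB e.2) ∈ π e} : Finset (A × B)).card : ℝ)
  have hGN : (G.card : ℝ) ≤ s * (s * N) :=
    hψA.trans (by gcongr; convert hψB.trans (mul_le_mul_of_nonneg_left hfinal hs0))
  have ht0 : 0 < t := by linarith
  set hA : ℝ := (({e ∈ E | s < (φA e.1).ncard} : Finset (A × B)).card : ℝ)
  set hB : ℝ := (({e ∈ E | s < (φB e.2).ncard} : Finset (A × B)).card : ℝ)
  have hheavy : s * (hA + hB) ≤ 2 * t * E.card := by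
    have h := mul_le_mul_of_nonneg_left hcost (Nat.cast_nonneg (α := ℝ) r)
    rw [← hAB] at h
    push_cast at h hheavyA hheavyB
    rw [hE]
    linarith
  have hheavy' : 3 * t * (hA + hB) ≤ 2 * E.card := by
    refine le_of_mul_le_mul_left ?_ ht0
    rw [hs] at hheavy
    linarith
  have hcov' : (E.card : ℝ) ≤ t * (G.card + hA + hB) := by
    rw [div_le_iff₀ ht0] at hcov
    calc (E.card : ℝ) ≤ _ := hcov
      _ ≤ _ := by rw [mul_comm]; gcongr
  have hEG : (E.card : ℝ) ≤ 3 * t * G.card := by linarith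
  have hN : 0 ≤ N := Nat.cast_nonneg _
  rw [div_le_iff₀ (by positivity)]
  calc (E.card : ℝ) ≤ 3 * t * (s * (s * N)) := hEG.trans (by gcongr)
    _ = N * (3 ^ 3 * t ^ 5) := by rw [hs]; ring
    _ ≤ N * (t ^ 3 * t ^ 5) := by gcongr
    _ = N * t ^ 8 := by ring
end

section
/- Let I=(A,B,E,L,(π_e)_{e∈E}) be a label cover instance with |A|=|B|=Δ, let ρ ≥ 2 be an integer, let G=G_{I,ρ} be the label cover graph, and let E' ⊆ E^T∖E(G). Let (i,j)∈E be an edge of I such that no edge of E' has its tail in A_i and its head in B_j. If dist_{(V, E(G)∪E')}(a^{(i)}, b^{(j)}) ≤ ρ+1, then the multilabeling ψ_{E'} covers the edge (i,j). -/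
/-- The adjacency relation of a digraph given by its edge set. -/
def digAdj {V : Type*} (E : Set (V × V)) : V → V → Prop := fun u v => (u, v) ∈ E

/-- Reachability (directed path of length ≥ 0). -/
def digReach {V : Type*} (E : Set (V × V)) : V → V → Prop :=
  Relation.ReflTransGen (digAdj E)

/-- The transitive-closure edge set: pairs joined by a directed path of length ≥ 1. -/
def digTC {V : Type*} (E : Set (V × V)) : Set (V × V) :=
  {p | Relation.TransGen (digAdj E) p.1 p.2}

/-- There is a directed walk of length `n` from `u` to `v`. -/
def hasWalk {V : Type*} (E : Set (V × V)) (u v : V) (n : ℕ) : Prop :=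
  ∃ f : ℕ → V, f 0 = u ∧ f n = v ∧ ∀ i < n, (f i, f (i + 1)) ∈ E

/-- The distance from `u` to `v` (number of edges of a shortest directed path; `⊤` if none). -/
noncomputable def digDist {V : Type*} (E : Set (V × V)) (u v : V) : ℕ∞ :=
  sInf {n : ℕ∞ | ∃ m : ℕ, hasWalk E u v m ∧ n = (m : ℕ∞)}

/-- The graph has diameter at most `d`: every reachable pair is at distance ≤ `d`. -/
def diamLE {V : Type*} (E : Set (V × V)) (d : ℕ) : Prop :=
  ∀ u v : V, (u, v) ∈ digTC E → digDist E u v ≤ (d : ℕ∞)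

/-- `E'` is an `(s,d)`-shortcut of the digraph with edge set `E`. -/
def IsShortcut {V : Type*} (E E' : Set (V × V)) (s d : ℕ) : Prop :=
  E' ⊆ digTC E \ E ∧ E'.ncard ≤ s ∧ diamLE (E ∪ E') d

/-- `E''` is an `(s,d)`-TC spanner of the digraph with edge set `E`. -/
def IsTCSpanner {V : Type*} (E E'' : Set (V × V)) (s d : ℕ) : Prop :=
  E'' ⊆ digTC E ∧ E''.ncard ≤ s ∧ digTC E'' = digTC E ∧ diamLE E'' d

/-- A digraph is acyclic if no vertex lies on a directed cycle. -/
def digAcyclic {V : Type*} (E : Set (V × V)) : Prop :=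
  ∀ v : V, ¬ Relation.TransGen (digAdj E) v v

/-- The set of vertices lying on some directed path from `u` to `v`. -/
def digBetween {V : Type*} (E : Set (V × V)) (u v : V) : Set V :=
  {w | digReach E u w ∧ digReach E w v}

/-- The vertices of the label cover graph `G_{I,ρ}` for a label cover instance with
`A = B = Fin Δ` and `L = Fin LL`: vertices `a^{(i)}, b^{(i)}`, fan endpoints
`α^{(i)}_j, β^{(i)}_j`, and internal path vertices `α^{(i)}_{j,k}, β^{(i)}_{j,k}`
(where `k : Fin (ρ-1)` encodes the index `k+1 ∈ {1,…,ρ-1}`). -/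
inductive LCV (Δ LL ρ : ℕ) : Type where
  | a (i : Fin Δ)
  | b (i : Fin Δ)
  | al (i : Fin Δ) (j : Fin LL)
  | be (i : Fin Δ) (j : Fin LL)
  | ap (i : Fin Δ) (j : Fin LL) (k : Fin (ρ - 1))
  | bp (i : Fin Δ) (j : Fin LL) (k : Fin (ρ - 1))
  deriving DecidableEq

/-- The edge relation of the label cover graph `G_{I,ρ}`. -/
inductive LCE {Δ LL ρ : ℕ} (Elc : Set (Fin Δ × Fin Δ))
    (π : Fin Δ × Fin Δ → Set (Fin LL × Fin LL)) :
    LCV Δ LL ρ → LCV Δ LL ρ → Prop where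
  /-- first edge of the path `a^{(i)} → α^{(i)}_{j,1}` -/
  | aFirst (i : Fin Δ) (j : Fin LL) (k : Fin (ρ - 1)) (hk : (k : ℕ) = 0) :
      LCE Elc π (.a i) (.ap i j k)
  /-- edge `α^{(i)}_{j,k} → α^{(i)}_{j,k+1}` -/
  | aStep (i : Fin Δ) (j : Fin LL) (k k' : Fin (ρ - 1)) (h : (k' : ℕ) = (k : ℕ) + 1) :
      LCE Elc π (.ap i j k) (.ap i j k')
  /-- last edge of the path `α^{(i)}_{j,ρ-1} → α^{(i)}_j` -/
  | aLast (i : Fin Δ) (j : Fin LL) (k : Fin (ρ - 1)) (hk : (k : ℕ) = ρ - 2) :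
      LCE Elc π (.ap i j k) (.al i j)
  /-- middle edge `α^{(i)}_j → β^{(i')}_{j'}` for `(i,i') ∈ E` and `(j,j') ∈ π_{(i,i')}` -/
  | mid (i i' : Fin Δ) (j j' : Fin LL) (hE : (i, i') ∈ Elc) (hπ : (j, j') ∈ π (i, i')) :
      LCE Elc π (.al i j) (.be i' j')
  /-- first edge of the path `β^{(i)}_j → β^{(i)}_{j,ρ-1}` -/
  | bFirst (i : Fin Δ) (j : Fin LL) (k : Fin (ρ - 1)) (hk : (k : ℕ) = ρ - 2) :
      LCE Elc π (.be i j) (.bp i j k)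
  /-- edge `β^{(i)}_{j,k+1} → β^{(i)}_{j,k}` -/
  | bStep (i : Fin Δ) (j : Fin LL) (k k' : Fin (ρ - 1)) (h : (k : ℕ) = (k' : ℕ) + 1) :
      LCE Elc π (.bp i j k) (.bp i j k')
  /-- last edge of the path `β^{(i)}_{j,1} → b^{(i)}` -/
  | bLast (i : Fin Δ) (j : Fin LL) (k : Fin (ρ - 1)) (hk : (k : ℕ) = 0) :
      LCE Elc π (.bp i j k) (.b i)
  /-- back edge `α^{(i)}_{j,k} → a^{(i)}` -/
  | backAp (i : Fin Δ) (j : Fin LL) (k : Fin (ρ - 1)) : LCE Elc π (.ap i j k) (.a i)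
  /-- back edge `α^{(i)}_j → a^{(i)}` -/
  | backAl (i : Fin Δ) (j : Fin LL) : LCE Elc π (.al i j) (.a i)
  /-- back edge `b^{(i)} → β^{(i)}_{j,k}` -/
  | backBp (i : Fin Δ) (j : Fin LL) (k : Fin (ρ - 1)) : LCE Elc π (.b i) (.bp i j k)
  /-- back edge `b^{(i)} → β^{(i)}_j` -/
  | backBe (i : Fin Δ) (j : Fin LL) : LCE Elc π (.b i) (.be i j)

/-- The edge set of the label cover graph `G_{I,ρ}`. -/
def LCEdges (Δ LL ρ : ℕ) (Elc : Set (Fin Δ × Fin Δ))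
    (π : Fin Δ × Fin Δ → Set (Fin LL × Fin LL)) :
    Set (LCV Δ LL ρ × LCV Δ LL ρ) :=
  {p | LCE Elc π p.1 p.2}

/-- The set `A_i` of vertices on the `A`-side with index `i`. -/
def Aside (Δ LL ρ : ℕ) (i : Fin Δ) : Set (LCV Δ LL ρ) :=
  fun v => match v with
  | .a i' => i' = i
  | .al i' _ => i' = i
  | .ap i' _ _ => i' = i
  | _ => False

/-- The set `B_i` of vertices on the `B`-side with index `i`. -/
def Bside (Δ LL ρ : ℕ) (i : Fin Δ) : Set (LCV Δ LL ρ) :=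
  fun v => match v with
  | .b i' => i' = i
  | .be i' _ => i' = i
  | .bp i' _ _ => i' = i
  | _ => False

/-- The multilabeling `ψ_{E'}` on the `A`-side:
`ψ_{E'}(i) = {j : dist_H(a^{(i)}, α^{(i)}_j) ≤ ρ-1}` where `H = G_{I,ρ} + E'`. -/
def psiA (Δ LL ρ : ℕ) (Elc : Set (Fin Δ × Fin Δ))
    (π : Fin Δ × Fin Δ → Set (Fin LL × Fin LL))
    (E' : Set (LCV Δ LL ρ × LCV Δ LL ρ)) (i : Fin Δ) : Set (Fin LL) :=
  {j | digDist (LCEdges Δ LL ρ Elc π ∪ E') (LCV.a i) (LCV.al i j) ≤ ((ρ - 1 : ℕ) : ℕ∞)}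

/-- The multilabeling `ψ_{E'}` on the `B`-side:
`ψ_{E'}(i) = {j : dist_H(β^{(i)}_j, b^{(i)}) ≤ ρ-1}` where `H = G_{I,ρ} + E'`. -/
def psiB (Δ LL ρ : ℕ) (Elc : Set (Fin Δ × Fin Δ))
    (π : Fin Δ × Fin Δ → Set (Fin LL × Fin LL))
    (E' : Set (LCV Δ LL ρ × LCV Δ LL ρ)) (i : Fin Δ) : Set (Fin LL) :=
  {j | digDist (LCEdges Δ LL ρ Elc π ∪ E') (LCV.be i j) (LCV.b i) ≤ ((ρ - 1 : ℕ) : ℕ∞)}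

theorem digDist_le_coe_iff {V : Type*} {E : Set (V × V)} {u v : V} {n : ℕ} :
    digDist E u v ≤ (n : ℕ∞) ↔ ∃ m ≤ n, hasWalk E u v m := by
  constructor
  · intro h
    by_cases hne : {n : ℕ∞ | ∃ m : ℕ, hasWalk E u v m ∧ n = (m : ℕ∞)}.Nonempty
    · obtain ⟨m, hm, heq⟩ := csInf_mem hne
      refine ⟨m, ?_, hm⟩
      have h' : (m : ℕ∞) ≤ n := heq ▸ h
      exact_mod_cast h'
    · rw [Set.not_nonempty_iff_eq_empty] at hne
      simp [digDist, hne] at h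
  · rintro ⟨m, hmn, hm⟩
    have hle : digDist E u v ≤ (m : ℕ∞) := sInf_le ⟨m, hm, rfl⟩
    exact hle.trans (by exact_mod_cast hmn)

/-- Paths of the label cover graph never leave a set `B_j`, and can leave a set `A_i` only
towards some `B_j`. -/
theorem side_of_mem_digTC {Δ LL ρ : ℕ} {Elc : Set (Fin Δ × Fin Δ)}
    {π : Fin Δ × Fin Δ → Set (Fin LL × Fin LL)} {u v : LCV Δ LL ρ}
    (h : (u, v) ∈ digTC (LCEdges Δ LL ρ Elc π)) :
    (∀ j, u ∈ Bside Δ LL ρ j → v ∈ Bside Δ LL ρ j) ∧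
      (∀ i, u ∈ Aside Δ LL ρ i → v ∈ Aside Δ LL ρ i ∨ ∃ j, v ∈ Bside Δ LL ρ j) := by
  have step : ∀ {x y : LCV Δ LL ρ}, LCE Elc π x y →
      (∀ j, x ∈ Bside Δ LL ρ j → y ∈ Bside Δ LL ρ j) ∧
      (∀ i, x ∈ Aside Δ LL ρ i → y ∈ Aside Δ LL ρ i ∨ ∃ j, y ∈ Bside Δ LL ρ j) := by
    intro x y hxy
    cases hxy with
    | mid => exact ⟨fun _ h => h.elim, fun _ _ => Or.inr ⟨_, rfl⟩⟩
    | _ =>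
      first
      | exact ⟨fun _ h => h.elim, fun _ h => Or.inl h⟩
      | exact ⟨fun _ h => h, fun _ h => h.elim⟩
  change Relation.TransGen (digAdj (LCEdges Δ LL ρ Elc π)) u v at h
  induction h with
  | single h => exact step h
  | tail _ h ih =>
    obtain ⟨hB, hA⟩ := step h
    refine ⟨fun j hj => hB j (ih.1 j hj), fun i hi => ?_⟩
    rcases ih.2 i hi with h' | ⟨j, h'⟩
    · exact hA i h'
    · exact Or.inr ⟨j, hB j h'⟩

/-- An edge of the label cover graph from `A_i` to `B_j` joins an `α` to a `β` vertex. -/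
theorem LCE.exists_of_mem_Aside_of_mem_Bside {Δ LL ρ : ℕ} {Elc : Set (Fin Δ × Fin Δ)}
    {π : Fin Δ × Fin Δ → Set (Fin LL × Fin LL)} {u v : LCV Δ LL ρ} {i j : Fin Δ}
    (h : LCE Elc π u v) (hu : u ∈ Aside Δ LL ρ i) (hv : v ∈ Bside Δ LL ρ j) :
    ∃ x y, u = .al i x ∧ v = .be j y ∧ (x, y) ∈ π (i, j) := by
  cases h with
  | mid i₁ j₁ x y _ hxy =>
    obtain rfl : i₁ = i := hu
    obtain rfl : j₁ = j := hv
    exact ⟨x, y, rfl, rfl, hxy⟩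
  | _ => first | exact hu.elim | exact hv.elim

/-- Let `E' ⊆ E^T∖E(G_{I,ρ})` and let `(i,j)` be an edge of `I` such that no
edge of `E'` has its tail in `A_i` and its head in `B_j`. If the distance from `a^{(i)}` to
`b^{(j)}` in `G_{I,ρ} + E'` is at most `ρ+1`, then `ψ_{E'}` covers `(i,j)`. -/
theorem stmt_5 (Δ LL ρ : ℕ) (hΔ : 1 ≤ Δ) (hρ : 2 ≤ ρ)
    (Elc : Set (Fin Δ × Fin Δ)) (π : Fin Δ × Fin Δ → Set (Fin LL × Fin LL))
    (hreg : ∃ r : ℕ, 1 ≤ r ∧ (∀ i : Fin Δ, {e ∈ Elc | e.1 = i}.ncard = r) ∧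
      (∀ j : Fin Δ, {e ∈ Elc | e.2 = j}.ncard = r))
    (hπ : ∀ e ∈ Elc, (π e).Nonempty)
    (E' : Set (LCV Δ LL ρ × LCV Δ LL ρ))
    (hE' : E' ⊆ digTC (LCEdges Δ LL ρ Elc π) \ LCEdges Δ LL ρ Elc π)
    (i j : Fin Δ) (hij : (i, j) ∈ Elc)
    (hnocross : ∀ e ∈ E', ¬ (e.1 ∈ Aside Δ LL ρ i ∧ e.2 ∈ Bside Δ LL ρ j))
    (hdist : digDist (LCEdges Δ LL ρ Elc π ∪ E') (LCV.a i) (LCV.b j) ≤ ((ρ + 1 : ℕ) : ℕ∞)) :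
    ∃ x ∈ psiA Δ LL ρ Elc π E' i, ∃ y ∈ psiB Δ LL ρ Elc π E' j, (x, y) ∈ π (i, j) := by
  obtain ⟨m, hm, f, hf0, hfm, hf⟩ := digDist_le_coe_iff.1 hdist
  have hside : ∀ k < m,
      (∀ j', f k ∈ Bside Δ LL ρ j' → f (k + 1) ∈ Bside Δ LL ρ j') ∧
      (∀ i', f k ∈ Aside Δ LL ρ i' →
        f (k + 1) ∈ Aside Δ LL ρ i' ∨ ∃ j', f (k + 1) ∈ Bside Δ LL ρ j') := by
    intro k hk
    rcases hf k hk with h | h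
    · exact side_of_mem_digTC (Relation.TransGen.single h)
    · exact side_of_mem_digTC (hE' h).1
  have hcross : ∃ k < m, f k ∈ Aside Δ LL ρ i ∧ ∃ j', f (k + 1) ∈ Bside Δ LL ρ j' := by
    by_contra! hno
    have hA : ∀ k ≤ m, f k ∈ Aside Δ LL ρ i := by
      intro k
      induction k with
      | zero => intro _; rw [hf0]; exact rfl
      | succ k ih =>
        intro hk
        have hAk := ih (by lia)
        rcases (hside k (by lia)).2 i hAk with h | ⟨j', h⟩
        · exact h
        · exact (hno k (by lia) hAk j' h).elim
    have hAm := hA m le_rfl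
    rw [hfm] at hAm
    exact hAm
  obtain ⟨k, hkm, hkA, j', hkB⟩ := hcross
  have hB : ∀ l, k + 1 ≤ l → l ≤ m → f l ∈ Bside Δ LL ρ j' := by
    intro l hl
    induction l, hl using Nat.le_induction with
    | base => exact fun _ => hkB
    | succ l _ ih => exact fun hlm => (hside l (by lia)).1 j' (ih (by lia))
  have hBm := hB m hkm le_rfl
  rw [hfm] at hBm
  obtain rfl : j = j' := hBm
  have hedge : LCE Elc π (f k) (f (k + 1)) :=
    (hf k hkm).resolve_right fun h => hnocross _ h ⟨hkA, hkB⟩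
  obtain ⟨x, y, hx, hy, hxy⟩ := hedge.exists_of_mem_Aside_of_mem_Bside hkA hkB
  have hk0 : k ≠ 0 := by
    rintro rfl
    simp [hf0] at hx
  have hkm' : k + 1 ≠ m := by
    rintro rfl
    simp [hfm] at hy
  refine ⟨x, digDist_le_coe_iff.2 ⟨k, by lia, f, hf0, hx, fun l hl => hf l (by lia)⟩,
    y, digDist_le_coe_iff.2 ⟨m - (k + 1), by lia, fun l => f (k + 1 + l), hy, ?_, ?_⟩, hxy⟩
  · simp only [Nat.add_sub_cancel' (show k + 1 ≤ m by lia), hfm]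
  · exact fun l hl => hf (k + 1 + l) (by lia)
end

section
/- Let I=(A,B,E,L,(π_e)_{e∈E}) be a label cover instance with |A|=|B|=Δ, let ρ ≥ 2 be an integer, let G=G_{I,ρ} be the label cover graph, and let E' ⊆ E^T∖E(G). Then the cost of the multilabeling ψ_{E'} satisfies Σ_{u∈A∪B}|ψ_{E'}(u)| ≤ |E'|. -/
section Potential

variable {V : Type*}

/-- A potential that grows by at most one along each edge grows by at most the distance. -/
theorem le_add_of_digDist_le {E : Set (V × V)} {u v : V} {n : ℕ} (g : V → ℤ)
    (hg : ∀ e ∈ E, g e.2 ≤ g e.1 + 1) (h : digDist E u v ≤ (n : ℕ∞)) : g v ≤ g u + n := by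
  have hne : {k : ℕ∞ | ∃ m : ℕ, hasWalk E u v m ∧ k = (m : ℕ∞)}.Nonempty := by
    by_contra hempty
    rw [digDist, Set.not_nonempty_iff_eq_empty.mp hempty, sInf_empty] at h
    exact absurd h (by simp)
  obtain ⟨m, ⟨f, rfl, rfl, hf⟩, hm⟩ := csInf_mem hne
  have hmn : m ≤ n := by
    rw [digDist, hm] at h
    exact_mod_cast h
  have hwalk : ∀ k ≤ m, g (f k) ≤ g (f 0) + k := by
    intro k
    induction k with
    | zero => simp
    | succ k ih =>
      intro hk
      have := ih (by omega)
      have := hg _ (hf k (by omega))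
      push_cast
      linarith
  have := hwalk m le_rfl
  omega

/-- If the distance in `E ∪ E'` is less than the increase of a potential that grows by at most one
along each edge of `E`, then some edge of `E'` increases the potential by more than one. -/
theorem exists_mem_of_digDist_union_le {E E' : Set (V × V)} {u v : V} {n : ℕ} (g : V → ℤ)
    (hg : ∀ e ∈ E, g e.2 ≤ g e.1 + 1) (h : digDist (E ∪ E') u v ≤ (n : ℕ∞))
    (hlt : g u + n < g v) : ∃ e ∈ E', g e.1 + 1 < g e.2 := by
  by_contra! hE'
  have := le_add_of_digDist_le g (fun e he => he.elim (hg e) (hE' e)) h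
  omega

end Potential

namespace LCV

variable {Δ LL ρ : ℕ}

instance : Finite (LCV Δ LL ρ) := by
  let F : LCV Δ LL ρ → (Fin Δ ⊕ Fin Δ) ⊕ ((Fin Δ × Fin LL) ⊕ (Fin Δ × Fin LL)) ⊕
      ((Fin Δ × Fin LL × Fin (ρ - 1)) ⊕ (Fin Δ × Fin LL × Fin (ρ - 1)))
    | a i => .inl (.inl i)
    | b i => .inl (.inr i)
    | al i j => .inr (.inl (.inl (i, j)))
    | be i j => .inr (.inl (.inr (i, j)))
    | ap i j k => .inr (.inr (.inl (i, j, k)))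
    | bp i j k => .inr (.inr (.inr (i, j, k)))
  refine Finite.of_injective F ?_
  intro x y h
  cases x <;> cases y <;> simp_all [F]

/-- The position of a vertex on the path from `a i` to `al i j`, and `0` off this path. -/
def depthA (i : Fin Δ) (j : Fin LL) : LCV Δ LL ρ → ℤ
  | al i' j' => if i' = i ∧ j' = j then ρ else 0
  | ap i' j' k => if i' = i ∧ j' = j then (k : ℤ) + 1 else 0
  | _ => 0

/-- The distance to `b i` along the path from `be i j` to `b i`, and `0` off this path. -/
def depthB (i : Fin Δ) (j : Fin LL) : LCV Δ LL ρ → ℤ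
  | be i' j' => if i' = i ∧ j' = j then ρ else 0
  | bp i' j' k => if i' = i ∧ j' = j then (k : ℤ) + 1 else 0
  | _ => 0

theorem depthA_nonneg (i : Fin Δ) (j : Fin LL) (v : LCV Δ LL ρ) : 0 ≤ depthA i j v := by
  cases v <;> simp only [depthA] <;> (try split_ifs) <;> omega

theorem depthB_nonneg (i : Fin Δ) (j : Fin LL) (v : LCV Δ LL ρ) : 0 ≤ depthB i j v := by
  cases v <;> simp only [depthB] <;> (try split_ifs) <;> omega

/-- Membership in the `B`-side of the label cover graph. -/
def IsB : LCV Δ LL ρ → Prop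
  | b _ | be _ _ | bp _ _ _ => True
  | _ => False

/-- The label charged for an edge: the `A`-path containing its head or else the `B`-path
containing its tail. -/
def edgeLabel : LCV Δ LL ρ × LCV Δ LL ρ → Option ((Fin Δ ⊕ Fin Δ) × Fin LL)
  | (_, al i j) | (_, ap i j _) => some (.inl i, j)
  | (be i j, _) | (bp i j _, _) => some (.inr i, j)
  | _ => none

theorem edgeLabel_of_depthA_pos {i : Fin Δ} {j : Fin LL} {u v : LCV Δ LL ρ}
    (h : 0 < depthA i j v) : edgeLabel (u, v) = some (.inl i, j) := by
  cases v <;> simp_all [depthA, edgeLabel] <;> grind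

theorem edgeLabel_of_depthB_pos {i : Fin Δ} {j : Fin LL} {u v : LCV Δ LL ρ}
    (h : 0 < depthB i j u) (hv : IsB v) : edgeLabel (u, v) = some (.inr i, j) := by
  cases v <;> cases u <;> simp_all [depthB, edgeLabel, IsB] <;> grind

theorem isB_of_depthB_pos {i : Fin Δ} {j : Fin LL} {u : LCV Δ LL ρ}
    (h : 0 < depthB i j u) : IsB u := by
  cases u <;> simp_all [depthB, IsB]

end LCV

namespace LCE

variable {Δ LL ρ : ℕ} {Elc : Set (Fin Δ × Fin Δ)} {π : Fin Δ × Fin Δ → Set (Fin LL × Fin LL)}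
  {u v : LCV Δ LL ρ}

theorem isB (h : LCE Elc π u v) (hu : u.IsB) : v.IsB := by
  cases h <;> simp_all [LCV.IsB]

theorem depthA_le (h : LCE Elc π u v) (i : Fin Δ) (j : Fin LL) :
    v.depthA i j ≤ u.depthA i j + 1 := by
  cases h <;> simp only [LCV.depthA] <;> (try split_ifs) <;> omega

theorem depthB_le (h : LCE Elc π u v) (i : Fin Δ) (j : Fin LL) :
    u.depthB i j ≤ v.depthB i j + 1 := by
  cases h <;> simp only [LCV.depthB] <;> (try split_ifs) <;> omega

theorem isB_of_mem_digTC (h : (u, v) ∈ digTC (LCEdges Δ LL ρ Elc π)) (hu : u.IsB) : v.IsB := by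
  obtain h : Relation.TransGen (LCE Elc π) u v := h
  induction h with
  | single h₁ => exact h₁.isB hu
  | tail _ h₁ ih => exact h₁.isB ih

end LCE

section Charging

variable {Δ LL ρ : ℕ} {Elc : Set (Fin Δ × Fin Δ)} {π : Fin Δ × Fin Δ → Set (Fin LL × Fin LL)}
  {E' : Set (LCV Δ LL ρ × LCV Δ LL ρ)} {i : Fin Δ} {j : Fin LL}

theorem exists_edgeLabel_of_mem_psiA (hρ : 1 ≤ ρ) (h : j ∈ psiA Δ LL ρ Elc π E' i) :
    ∃ e ∈ E', LCV.edgeLabel e = some (.inl i, j) := by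
  obtain ⟨e, he, hlt⟩ := exists_mem_of_digDist_union_le (LCV.depthA i j)
    (fun _ he => LCE.depthA_le he i j) h (by simp [LCV.depthA]; omega)
  have := LCV.depthA_nonneg i j e.1
  exact ⟨e, he, LCV.edgeLabel_of_depthA_pos (by omega)⟩

theorem exists_edgeLabel_of_mem_psiB (hρ : 1 ≤ ρ) (hE' : E' ⊆ digTC (LCEdges Δ LL ρ Elc π))
    (h : j ∈ psiB Δ LL ρ Elc π E' i) :
    ∃ e ∈ E', LCV.edgeLabel e = some (.inr i, j) := by
  obtain ⟨e, he, hlt⟩ := exists_mem_of_digDist_union_le (fun v => -LCV.depthB i j v)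
    (fun _ he => by have := LCE.depthB_le he i j; omega) h (by simp [LCV.depthB]; omega)
  have := LCV.depthB_nonneg i j e.2
  have hpos : 0 < LCV.depthB i j e.1 := by omega
  exact ⟨e, he, LCV.edgeLabel_of_depthB_pos hpos
    (LCE.isB_of_mem_digTC (hE' he) (LCV.isB_of_depthB_pos hpos))⟩

end Charging

/-- For every `E' ⊆ E^T∖E(G_{I,ρ})`, the cost of the multilabeling `ψ_{E'}`
is at most `|E'|`. -/
theorem stmt_6 (Δ LL ρ : ℕ) (hΔ : 1 ≤ Δ) (hρ : 2 ≤ ρ)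
    (Elc : Set (Fin Δ × Fin Δ)) (π : Fin Δ × Fin Δ → Set (Fin LL × Fin LL))
    (hreg : ∃ r : ℕ, 1 ≤ r ∧ (∀ i : Fin Δ, {e ∈ Elc | e.1 = i}.ncard = r) ∧
      (∀ j : Fin Δ, {e ∈ Elc | e.2 = j}.ncard = r))
    (hπ : ∀ e ∈ Elc, (π e).Nonempty)
    (E' : Set (LCV Δ LL ρ × LCV Δ LL ρ))
    (hE' : E' ⊆ digTC (LCEdges Δ LL ρ Elc π) \ LCEdges Δ LL ρ Elc π) :
    (∑ i : Fin Δ, (psiA Δ LL ρ Elc π E' i).ncard) +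
      (∑ i : Fin Δ, (psiB Δ LL ρ Elc π E' i).ncard) ≤ E'.ncard := by
  let T : Fin Δ ⊕ Fin Δ → Set (Fin LL) :=
    Sum.elim (psiA Δ LL ρ Elc π E') (psiB Δ LL ρ Elc π E')
  have hcharge : ∀ s : Σ x, T x, ∃ e : E', LCV.edgeLabel e.1 = some (s.1, s.2.1) := by
    rintro ⟨i | i, j, hj⟩
    · obtain ⟨e, he, h⟩ := exists_edgeLabel_of_mem_psiA (by omega) hj
      exact ⟨⟨e, he⟩, h⟩
    · obtain ⟨e, he, h⟩ :=
        exists_edgeLabel_of_mem_psiB (by omega) (fun e he => (hE' he).1) hj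
      exact ⟨⟨e, he⟩, h⟩
  choose c hc using hcharge
  have hinj : Function.Injective c := by
    rintro ⟨x, j, hj⟩ ⟨y, k, hk⟩ h
    have h' := (hc ⟨x, j, hj⟩).symm.trans (h ▸ hc ⟨y, k, hk⟩)
    obtain ⟨rfl, rfl⟩ : x = y ∧ j = k := by simpa using h'
    rfl
  have hcard := Nat.card_le_card_of_injective c hinj
  rw [Nat.card_sigma, Fintype.sum_sum_type] at hcard
  exact hcard
end

section
/- Let I=(A,B,E,L,(π_e)_{e∈E}) be a label cover instance with |A|=|B|=Δ, let ρ ≥ 2 be an integer, let δ∈[0,1] be a real number, and let E' ⊆ E^T∖E(G_{I,ρ}) be a set such that every multilabeling of I of cost at most |E'| covers at most δ|E| edges of I. Then the number of edges (i,j)∈E with dist_{(V, E(G_{I,ρ})∪E')}(a^{(i)}, b^{(j)}) ≤ ρ+1 is at most δ|E| + |E'|. -/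
theorem hasWalk_of_digDist_le {V : Type*} {E : Set (V × V)} {u v : V} {d : ℕ}
    (h : digDist E u v ≤ (d : ℕ∞)) : ∃ m ≤ d, hasWalk E u v m := by
  unfold digDist at h
  have hne : {n : ℕ∞ | ∃ m : ℕ, hasWalk E u v m ∧ n = (m : ℕ∞)}.Nonempty := by
    by_contra hemp
    rw [Set.not_nonempty_iff_eq_empty] at hemp
    rw [hemp, sInf_empty] at h
    exact ENat.natCast_ne_top d (top_le_iff.mp h)
  obtain ⟨m, hm, hmeq⟩ := csInf_mem hne
  rw [hmeq] at h
  exact ⟨m, by exact_mod_cast h, hm⟩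

theorem Set.ncard_le_ncard_of_rel {α β : Type*} {S : Set α} {T : Set β} (hT : T.Finite)
    (r : α → β → Prop) (hex : ∀ x ∈ S, ∃ y ∈ T, r x y)
    (hr : ∀ x x' y, r x y → r x' y → x = x') : S.ncard ≤ T.ncard := by
  rcases S.eq_empty_or_nonempty with rfl | ⟨x₀, hx₀⟩
  · simp
  have : Nonempty β := ⟨(hex x₀ hx₀).choose⟩
  choose! f hfT hf using hex
  refine Set.ncard_le_ncard_of_injOn f hfT (fun x hx x' hx' hxx' => ?_) hT
  exact hr x x' (f x) (hf x hx) (hxx' ▸ hf x' hx')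

theorem sum_ncard_eq_ncard_sigma {ι κ : Type*} [Fintype ι] [Finite κ] (φ : ι → Set κ) :
    ∑ i, (φ i).ncard = {p : ι × κ | p.2 ∈ φ p.1}.ncard := by
  classical
  have := Fintype.ofFinite κ
  simp only [Set.ncard_eq_toFinset_card']
  rw [Finset.card_eq_sum_card_fiberwise (f := Prod.fst) (t := Finset.univ) (by simp)]
  refine Finset.sum_congr rfl fun i _ => ?_
  refine Finset.card_bij (fun k _ => (i, k)) (by simp) (by simp) ?_
  rintro ⟨i', k⟩ h
  simp only [Finset.mem_filter, Set.mem_toFinset, Set.mem_ofPred_eq] at h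
  obtain ⟨h, rfl⟩ := h
  exact ⟨k, by simpa using h, rfl⟩

theorem le_add_of_walk_step {V : Type*} {f : ℕ → V} {n : ℕ} {h : V → ℕ}
    (hf : ∀ i < n, h (f (i + 1)) ≤ h (f i) + 1) {t : ℕ} (ht : t ≤ n) :
    h (f t) ≤ h (f 0) + t := by
  induction t with
  | zero => simp
  | succ t ih =>
    have := ih (by omega)
    have := hf t (by omega)
    omega

theorem le_add_of_walk_step_back {V : Type*} {f : ℕ → V} {n : ℕ} {h : V → ℕ}
    (hf : ∀ i < n, h (f i) ≤ h (f (i + 1)) + 1) {s t : ℕ} (ht : s + t = n) :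
    h (f s) ≤ h (f n) + t := by
  induction t generalizing s with
  | zero => obtain rfl : s = n := by omega
            simp
  | succ t ih =>
    have := ih (s := s + 1) (by omega)
    have := hf s (by omega)
    omega

namespace LCV

variable {Δ LL ρ : ℕ}

instance inst_s7 : Finite (LCV Δ LL ρ) := by
  let F : (Fin Δ ⊕ Fin Δ) ⊕ ((Fin Δ × Fin LL) ⊕ (Fin Δ × Fin LL)) ⊕
      ((Fin Δ × Fin LL × Fin (ρ - 1)) ⊕ (Fin Δ × Fin LL × Fin (ρ - 1))) → LCV Δ LL ρ := fun x =>
    match x with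
    | .inl (.inl i) => .a i
    | .inl (.inr i) => .b i
    | .inr (.inl (.inl (i, j))) => .al i j
    | .inr (.inl (.inr (i, j))) => .be i j
    | .inr (.inr (.inl (i, j, k))) => .ap i j k
    | .inr (.inr (.inr (i, j, k))) => .bp i j k
  refine Finite.of_surjective F fun v => ?_
  cases v with
  | a i => exact ⟨.inl (.inl i), rfl⟩
  | b i => exact ⟨.inl (.inr i), rfl⟩
  | al i j => exact ⟨.inr (.inl (.inl (i, j))), rfl⟩
  | be i j => exact ⟨.inr (.inl (.inr (i, j))), rfl⟩
  | ap i j k => exact ⟨.inr (.inr (.inl (i, j, k))), rfl⟩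
  | bp i j k => exact ⟨.inr (.inr (.inr (i, j, k))), rfl⟩

/-- The vertex of the label cover instance whose gadget contains a given vertex: `Sum.inl i` for
the gadget of `i ∈ A` and `Sum.inr i` for the gadget of `i ∈ B`. -/
def gadget : LCV Δ LL ρ → Fin Δ ⊕ Fin Δ
  | .a i => .inl i
  | .al i _ => .inl i
  | .ap i _ _ => .inl i
  | .b i => .inr i
  | .be i _ => .inr i
  | .bp i _ _ => .inr i

/-- The label of the path containing a given vertex, if it lies on one. -/
def label : LCV Δ LL ρ → Option (Fin LL)
  | .a _ => none
  | .b _ => none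
  | .al _ j => some j
  | .ap _ j _ => some j
  | .be _ j => some j
  | .bp _ j _ => some j

/-- The distance of a vertex along its path from the centre `a^{(i)}` or `b^{(i)}`. -/
def depth : LCV Δ LL ρ → ℕ
  | .a _ => 0
  | .b _ => 0
  | .al _ _ => ρ
  | .be _ _ => ρ
  | .ap _ _ k => k + 1
  | .bp _ _ k => k + 1

/-- The depth of a vertex on the path of a fixed gadget and label, and `0` off that path. -/
def depthOn (g : Fin Δ ⊕ Fin Δ) (j : Fin LL) (v : LCV Δ LL ρ) : ℕ :=
  if v.gadget = g ∧ v.label = some j then v.depth else 0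

/-- The order in which walks traverse the gadgets. -/
def gadgetLE (x y : Fin Δ ⊕ Fin Δ) : Prop := x = y ∨ x.isLeft ∧ y.isRight

theorem gadgetLE_trans {x y z : Fin Δ ⊕ Fin Δ} (h : gadgetLE x y) (h' : gadgetLE y z) :
    gadgetLE x z := by
  rcases x with x | x <;> rcases y with y | y <;> rcases z with z | z <;>
    simp_all [gadgetLE]

variable {Elc : Set (Fin Δ × Fin Δ)} {π : Fin Δ × Fin Δ → Set (Fin LL × Fin LL)}

theorem gadgetLE_of_edge {u v : LCV Δ LL ρ} (h : LCE Elc π u v) :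
    gadgetLE u.gadget v.gadget := by
  cases h <;> simp [gadgetLE, gadget]

theorem gadgetLE_of_mem_digTC {p : LCV Δ LL ρ × LCV Δ LL ρ}
    (h : p ∈ digTC (LCEdges Δ LL ρ Elc π)) : gadgetLE p.1.gadget p.2.gadget := by
  obtain ⟨u, v⟩ := p
  replace h : Relation.TransGen (digAdj (LCEdges Δ LL ρ Elc π)) u v := h
  induction h with
  | single h => exact gadgetLE_of_edge h
  | tail _ h ih => exact gadgetLE_trans ih (gadgetLE_of_edge h)

theorem depthOn_inl_le_of_edge (hρ : 2 ≤ ρ) (i : Fin Δ) (j : Fin LL) {u v : LCV Δ LL ρ}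
    (h : LCE Elc π u v) : depthOn (.inl i) j v ≤ depthOn (.inl i) j u + 1 := by
  cases h <;> simp only [depthOn, gadget, label, depth] <;> simp only [Sum.inl.injEq, reduceCtorEq,
    Option.some.injEq, false_and, and_false, if_false] <;> (try split_ifs) <;> omega

theorem depthOn_inr_le_of_edge (hρ : 2 ≤ ρ) (i : Fin Δ) (j : Fin LL) {u v : LCV Δ LL ρ}
    (h : LCE Elc π u v) : depthOn (.inr i) j u ≤ depthOn (.inr i) j v + 1 := by
  cases h <;> simp only [depthOn, gadget, label, depth] <;> simp only [Sum.inr.injEq, reduceCtorEq,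
    Option.some.injEq, false_and, and_false, if_false] <;> (try split_ifs) <;> omega

theorem depthOn_eq_zero {g : Fin Δ ⊕ Fin Δ} {j : Fin LL} {v : LCV Δ LL ρ}
    (h : ¬ (v.gadget = g ∧ v.label = some j)) : depthOn g j v = 0 := if_neg h

/-- The labels of `i ∈ A` whose path is entered by an edge of `E'`. -/
def labelsA (E' : Set (LCV Δ LL ρ × LCV Δ LL ρ)) (i : Fin Δ) : Set (Fin LL) :=
  {j | ∃ e ∈ E', e.2.gadget = .inl i ∧ e.2.label = some j}

/-- The labels of `i ∈ B` whose path is left by an edge of `E'`. -/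
def labelsB (E' : Set (LCV Δ LL ρ × LCV Δ LL ρ)) (i : Fin Δ) : Set (Fin LL) :=
  {j | ∃ e ∈ E', e.1.gadget = .inr i ∧ e.1.label = some j}

/-- The pairs `(i, i')` joined by an edge of `E'` between their gadgets. -/
def crossing (E' : Set (LCV Δ LL ρ × LCV Δ LL ρ)) : Set (Fin Δ × Fin Δ) :=
  {p | ∃ e ∈ E', e.1.gadget = .inl p.1 ∧ e.2.gadget = .inr p.2}

theorem ncard_crossing_le (E' : Set (LCV Δ LL ρ × LCV Δ LL ρ)) :
    (crossing E').ncard ≤ E'.ncard := by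
  refine Set.ncard_le_ncard_of_rel (Set.toFinite _)
    (fun p e => e.1.gadget = .inl p.1 ∧ e.2.gadget = .inr p.2) (fun p hp => hp) ?_
  rintro ⟨i, i'⟩ ⟨k, k'⟩ e ⟨h₁, h₂⟩ ⟨h₃, h₄⟩
  simp_all

theorem cost_le {E' : Set (LCV Δ LL ρ × LCV Δ LL ρ)}
    (hE' : ∀ e ∈ E', gadgetLE e.1.gadget e.2.gadget) :
    ∑ i, (labelsA E' i).ncard + ∑ i, (labelsB E' i).ncard ≤ E'.ncard := by
  have hA : ∑ i, (labelsA E' i).ncard ≤ {e ∈ E' | e.2.gadget.isLeft}.ncard := by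
    rw [sum_ncard_eq_ncard_sigma]
    refine Set.ncard_le_ncard_of_rel (Set.toFinite _)
      (fun p e => e.2.gadget = .inl p.1 ∧ e.2.label = some p.2) ?_ ?_
    · rintro ⟨i, j⟩ ⟨e, he, h₁, h₂⟩
      exact ⟨e, ⟨he, by simp [h₁]⟩, h₁, h₂⟩
    · rintro ⟨i, i'⟩ ⟨k, k'⟩ e ⟨h₁, h₂⟩ ⟨h₃, h₄⟩
      simp_all
  have hB : ∑ i, (labelsB E' i).ncard ≤ {e ∈ E' | e.1.gadget.isRight}.ncard := by
    rw [sum_ncard_eq_ncard_sigma]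
    refine Set.ncard_le_ncard_of_rel (Set.toFinite _)
      (fun p e => e.1.gadget = .inr p.1 ∧ e.1.label = some p.2) ?_ ?_
    · rintro ⟨i, j⟩ ⟨e, he, h₁, h₂⟩
      exact ⟨e, ⟨he, by simp [h₁]⟩, h₁, h₂⟩
    · rintro ⟨i, i'⟩ ⟨k, k'⟩ e ⟨h₁, h₂⟩ ⟨h₃, h₄⟩
      simp_all
  refine (add_le_add hA hB).trans ?_
  rw [← Set.ncard_union_eq ?_ (Set.toFinite _) (Set.toFinite _)]
  · exact Set.ncard_le_ncard (by rintro e (h | h) <;> exact h.1) (Set.toFinite _)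
  · rw [Set.disjoint_left]
    rintro e ⟨he, h₁⟩ ⟨-, h₂⟩
    have := hE' e he
    rcases h : e.1.gadget with x | x <;> rcases h' : e.2.gadget with y | y <;>
      simp_all [gadgetLE]

theorem exists_mid_of_edge {u v : LCV Δ LL ρ} {i i' : Fin Δ} (h : LCE Elc π u v)
    (hu : u.gadget = .inl i) (hv : v.gadget = .inr i') :
    ∃ j j', u = .al i j ∧ v = .be i' j' ∧ (j, j') ∈ π (i, i') := by
  cases h <;> simp_all [gadget]

theorem exists_crossing_step {f : ℕ → LCV Δ LL ρ} {n : ℕ} {i i' : Fin Δ}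
    (hf : ∀ t < n, gadgetLE (f t).gadget (f (t + 1)).gadget)
    (h0 : (f 0).gadget = .inl i) (hn : (f n).gadget = .inr i') :
    ∃ t < n, (f t).gadget = .inl i ∧ (f (t + 1)).gadget = .inr i' := by
  induction n with
  | zero => simp_all
  | succ n ih =>
    have hstep := hf n (by omega)
    rcases hg : (f n).gadget with k | k
    · have key : ∀ t ≤ n, gadgetLE (Sum.inl i) (f t).gadget := by
        intro t ht
        induction t with
        | zero => exact .inl h0.symm
        | succ t iht => exact gadgetLE_trans (iht (by omega)) (hf t (by omega))
      have := key n le_rfl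
      refine ⟨n, by omega, ?_, hn⟩
      simp_all [gadgetLE]
    · have hk : (f n).gadget = .inr i' := by simp_all [gadgetLE]
      obtain ⟨t, ht, h⟩ := ih (fun t ht => hf t (by omega)) hk
      exact ⟨t, by omega, h⟩

theorem covered_or_crossing (hρ : 2 ≤ ρ) {E' : Set (LCV Δ LL ρ × LCV Δ LL ρ)}
    (hE' : ∀ e ∈ E', gadgetLE e.1.gadget e.2.gadget) {i i' : Fin Δ} {n : ℕ} (hn : n ≤ ρ + 1)
    (hw : hasWalk (LCEdges Δ LL ρ Elc π ∪ E') (.a i) (.b i') n) :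
    (∃ x ∈ labelsA E' i, ∃ y ∈ labelsB E' i', (x, y) ∈ π (i, i')) ∨ (i, i') ∈ crossing E' := by
  obtain ⟨f, hf0, hfn, hf⟩ := hw
  have hle : ∀ t < n, gadgetLE (f t).gadget (f (t + 1)).gadget := fun t ht =>
    (hf t ht).elim gadgetLE_of_edge (hE' _)
  obtain ⟨t, htn, htA, htB⟩ := exists_crossing_step hle
    (i := i) (i' := i') (by rw [hf0]; rfl) (by rw [hfn]; rfl)
  rcases hf t htn with he | he
  · left
    obtain ⟨j, j', hu, hv, hjj⟩ := exists_mid_of_edge (u := f t) (v := f (t + 1)) he htA htB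
    have ht0 : t ≠ 0 := by rintro rfl; simp_all
    have htn' : t + 1 ≠ n := by rintro rfl; simp_all
    refine ⟨j, ?_, j', ?_, hjj⟩
    · by_contra hj
      have := le_add_of_walk_step (f := f) (h := depthOn (.inl i) j) (n := n) (fun s hs =>
        (hf s hs).elim (depthOn_inl_le_of_edge hρ i j) fun h => by
          rw [depthOn_eq_zero fun h' => hj ⟨_, h, h'⟩]; omega) htn.le
      rw [hu] at this
      simp [hf0, depthOn, gadget, label, depth] at this
      omega
    · by_contra hj
      have := le_add_of_walk_step_back (f := f) (h := depthOn (.inr i') j') (n := n) (fun s hs =>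
        (hf s hs).elim (depthOn_inr_le_of_edge hρ i' j') fun h => by
          rw [depthOn_eq_zero fun h' => hj ⟨_, h, h'⟩]; omega)
        (s := t + 1) (t := n - (t + 1)) (by omega)
      rw [hv] at this
      simp [hfn, depthOn, gadget, label, depth] at this
      omega
  · exact .inr ⟨_, he, htA, htB⟩

end LCV

/-- Let `δ ∈ [0,1]` and `E' ⊆ E^T∖E(G_{I,ρ})` be such that every multilabeling
of `I` of cost at most `|E'|` covers at most `δ|E|` edges of `I`. Then the number of edges
`(i,j) ∈ E` with `dist_{G_{I,ρ}+E'}(a^{(i)}, b^{(j)}) ≤ ρ+1` is at most `δ|E| + |E'|`. -/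
theorem stmt_7 (Δ LL ρ : ℕ) (hΔ : 1 ≤ Δ) (hρ : 2 ≤ ρ)
    (Elc : Set (Fin Δ × Fin Δ)) (π : Fin Δ × Fin Δ → Set (Fin LL × Fin LL))
    (hreg : ∃ r : ℕ, 1 ≤ r ∧ (∀ i : Fin Δ, {e ∈ Elc | e.1 = i}.ncard = r) ∧
      (∀ j : Fin Δ, {e ∈ Elc | e.2 = j}.ncard = r))
    (hπ : ∀ e ∈ Elc, (π e).Nonempty)
    (δ : ℝ) (hδ0 : 0 ≤ δ) (hδ1 : δ ≤ 1)
    (E' : Set (LCV Δ LL ρ × LCV Δ LL ρ))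
    (hE' : E' ⊆ digTC (LCEdges Δ LL ρ Elc π) \ LCEdges Δ LL ρ Elc π)
    (hsound : ∀ φA φB : Fin Δ → Set (Fin LL),
      (∑ i : Fin Δ, (φA i).ncard) + (∑ i : Fin Δ, (φB i).ncard) ≤ E'.ncard →
      ({e ∈ Elc | ∃ x ∈ φA e.1, ∃ y ∈ φB e.2, (x, y) ∈ π e}.ncard : ℝ) ≤ δ * (Elc.ncard : ℝ)) :
    ({e ∈ Elc |
        digDist (LCEdges Δ LL ρ Elc π ∪ E') (LCV.a e.1) (LCV.b e.2) ≤ ((ρ + 1 : ℕ) : ℕ∞)}.ncard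
      : ℝ) ≤ δ * (Elc.ncard : ℝ) + (E'.ncard : ℝ) := by
  have hLE : ∀ e ∈ E', LCV.gadgetLE e.1.gadget e.2.gadget := fun e he =>
    LCV.gadgetLE_of_mem_digTC (hE' he).1
  have hcov := hsound (LCV.labelsA E') (LCV.labelsB E') (LCV.cost_le hLE)
  have hcross : ((LCV.crossing E').ncard : ℝ) ≤ E'.ncard := by
    exact_mod_cast LCV.ncard_crossing_le E'
  refine le_trans ?_ (add_le_add hcov hcross)
  norm_cast
  refine le_trans (Set.ncard_le_ncard ?_ (Set.toFinite _)) (Set.ncard_union_le _ _)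
  rintro ⟨i, i'⟩ ⟨he, hd⟩
  obtain ⟨n, hn, hw⟩ := hasWalk_of_digDist_le hd
  exact (LCV.covered_or_crossing hρ hLE hn hw).imp (fun h => ⟨he, h⟩) id
end

section
/- Let G=(V,E) be a directed acyclic graph with transitive-closure edge set E^T, let P be a directed path in G with vertex set S, and let F ⊆ E^T. Suppose that in the graph H=(V, E∪F), every pair u,v∈S with (u,v)∈E^T satisfies dist_H(u,v) ≤ 2. Then every shortest directed path in H (i.e., every path between two vertices whose length equals their distance in H) contains at most 3 vertices of S. -/
theorem hasWalk.trans {V : Type*} {E : Set (V × V)} {u v w : V} {a b : ℕ}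
    (h₁ : hasWalk E u v a) (h₂ : hasWalk E v w b) : hasWalk E u w (a + b) := by
  obtain ⟨f, hf0, hfa, hf⟩ := h₁
  obtain ⟨g, hg0, hgb, hg⟩ := h₂
  refine ⟨fun i => if i < a then f i else g (i - a), ?_, by simp [hgb], fun i hi => ?_⟩
  · rcases Nat.eq_zero_or_pos a with rfl | ha
    · simp [hg0, ← hfa, hf0]
    · simp [ha, hf0]
  · rcases lt_trichotomy (i + 1) a with h | h | h
    · simpa [h, Nat.lt_of_succ_lt h] using hf i (by omega)
    · have := hf i (by omega)
      rw [h, hfa, ← hg0] at this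
      simpa [h, show i < a by omega] using this
    · have := hg (i - a) (by omega)
      rw [show i - a + 1 = i + 1 - a by omega] at this
      simpa [show ¬ i < a by omega, show ¬ i + 1 < a by omega] using this

theorem digDist_le_of_hasWalk {V : Type*} {E : Set (V × V)} {u v : V} {n : ℕ}
    (h : hasWalk E u v n) : digDist E u v ≤ (n : ℕ∞) :=
  sInf_le ⟨n, h, rfl⟩

theorem exists_hasWalk_of_digDist_le {V : Type*} {E : Set (V × V)} {u v : V} {n : ℕ}
    (h : digDist E u v ≤ (n : ℕ∞)) : ∃ k ≤ n, hasWalk E u v k := by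
  have hne : {n : ℕ∞ | ∃ m : ℕ, hasWalk E u v m ∧ n = (m : ℕ∞)}.Nonempty := by
    by_contra hempty
    rw [Set.not_nonempty_iff_eq_empty] at hempty
    simp [digDist, hempty] at h
  obtain ⟨k, hk, hkd⟩ := csInf_mem hne
  refine ⟨k, ?_, hk⟩
  rw [digDist, hkd] at h
  exact_mod_cast h

theorem hasWalk_of_fin_path {V : Type*} {E : Set (V × V)} {m : ℕ} {g : Fin (m + 1) → V}
    (hg : ∀ i : Fin m, (g i.castSucc, g i.succ) ∈ E) {i j : Fin (m + 1)} (hij : i ≤ j) :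
    hasWalk E (g i) (g j) (j - i : ℕ) := by
  have hij' : (i : ℕ) ≤ j := hij
  refine ⟨fun k => g ⟨min (i + k) m, by omega⟩, ?_, ?_, fun k hk => ?_⟩
  · exact congrArg g (Fin.ext (by simp; omega))
  · exact congrArg g (Fin.ext (by simp; omega))
  · convert hg ⟨i + k, by omega⟩ using 3 <;> (apply Fin.ext; simp; omega)

theorem hasWalk.mem_digTC {V : Type*} {E E' : Set (V × V)} (hE : E' ⊆ digTC E) {u v : V}
    {n : ℕ} (hn : 0 < n) (h : hasWalk E' u v n) : (u, v) ∈ digTC E := by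
  obtain ⟨f, rfl, rfl, hf⟩ := h
  induction n, hn using Nat.le_induction with
  | base => exact hE (hf 0 one_pos)
  | succ n hn ih =>
    exact Relation.TransGen.trans (ih fun i hi => hf i (by omega)) (hE (hf n (by omega)))

theorem sub_le_of_hasWalk_of_shortest {V : Type*} {E : Set (V × V)} {m : ℕ}
    {g : Fin (m + 1) → V} (hg : ∀ i : Fin m, (g i.castSucc, g i.succ) ∈ E)
    (hshortest : digDist E (g 0) (g (Fin.last m)) = (m : ℕ∞)) {i j : Fin (m + 1)} {k : ℕ}
    (h : hasWalk E (g i) (g j) k) : (j : ℕ) ≤ i + k := by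
  have hw := ((hasWalk_of_fin_path hg (Fin.zero_le i)).trans h).trans
    (hasWalk_of_fin_path hg (Fin.le_last j))
  have hle := digDist_le_of_hasWalk hw
  rw [hshortest, Nat.cast_le] at hle
  simp only [Fin.val_zero, Fin.val_last] at hle
  omega

theorem Fin.ncard_le_of_forall_le_add {m d : ℕ} {s : Set (Fin m)}
    (h : ∀ i ∈ s, ∀ j ∈ s, (j : ℕ) ≤ i + d) : s.ncard ≤ d + 1 := by
  rcases s.eq_empty_or_nonempty with rfl | hs
  · simp
  obtain ⟨a, ha, hmin⟩ := s.toFinite.exists_minimal hs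
  rw [← Set.ncard_image_of_injective s Fin.val_injective]
  have hsub : Fin.val '' s ⊆ (Finset.Icc (a : ℕ) (a + d) : Set ℕ) := by
    rintro _ ⟨j, hj, rfl⟩
    have haj : a ≤ j := (le_total a j).elim id (hmin hj)
    simpa using ⟨haj, h a ha j hj⟩
  calc (Fin.val '' s).ncard ≤ (Finset.Icc (a : ℕ) (a + d) : Set ℕ).ncard :=
        Set.ncard_le_ncard hsub (Finset.finite_toSet _)
    _ = d + 1 := by rw [Set.ncard_coe_finset, Nat.card_Icc]; omega

/-- Let `G=(V,E)` be a DAG, `P` a directed path in `G` with vertex set `S`,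
and `F ⊆ E^T`. If in `H=(V,E∪F)` every pair `u,v ∈ S` with `(u,v) ∈ E^T` satisfies
`dist_H(u,v) ≤ 2`, then every shortest directed path in `H` contains at most 3 vertices
of `S`. -/
theorem stmt_9 {V : Type*} (E : Set (V × V)) (hsimple : ∀ v : V, (v, v) ∉ E)
    (hacyc : digAcyclic E)
    (F : Set (V × V)) (hF : F ⊆ digTC E)
    -- the directed path P in G, with vertex set S
    (n : ℕ) (p : Fin (n + 1) → V) (hpinj : Function.Injective p)
    (hpE : ∀ i : Fin n, (p i.castSucc, p i.succ) ∈ E)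
    (S : Set V) (hS : S = Set.range p)
    (hsettle : ∀ u ∈ S, ∀ v ∈ S, (u, v) ∈ digTC E → digDist (E ∪ F) u v ≤ (2 : ℕ∞))
    -- a shortest directed path in H = (V, E ∪ F)
    (m : ℕ) (g : Fin (m + 1) → V)
    (hg : ∀ i : Fin m, (g i.castSucc, g i.succ) ∈ E ∪ F)
    (hshortest : digDist (E ∪ F) (g 0) (g (Fin.last m)) = (m : ℕ∞)) :
    {i : Fin (m + 1) | g i ∈ S}.ncard ≤ 3 := by
  have hsub : E ∪ F ⊆ digTC E :=
    Set.union_subset (fun _ he => Relation.TransGen.single he) hF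
  refine Fin.ncard_le_of_forall_le_add (d := 2) fun i hi j hj => ?_
  rcases le_or_gt j i with hji | hij
  · have : (j : ℕ) ≤ i := hji
    omega
  have hTC : (g i, g j) ∈ digTC E :=
    (hasWalk_of_fin_path hg hij.le).mem_digTC hsub (Nat.sub_pos_of_lt hij)
  obtain ⟨k, hk, hw⟩ := exists_hasWalk_of_digDist_le (n := 2) (hsettle _ hi _ hj hTC)
  have := sub_le_of_hasWalk_of_shortest hg hshortest hw
  omega
end

section
/- There is a universal constant C such that the following holds for every integer n ≥ 2, every n-vertex directed acyclic graph G=(V,E), every integer β with 1 ≤ β ≤ n, and every integer D with C·log n ≤ D ≤ n^{0.34}: there exists a set F ⊆ E^T∖E with |F| ≤ C·(n²·(log n)²/(β·D²) + n·log n) such that F D-settles every β-thick pair (u,v)∈E^T. -/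
section HittingSet

/-- One greedy step: some element of the universe hits an average share of the family. -/
lemma exists_mem_many_sets {α ι : Type*} [DecidableEq α] (U : Finset α) (J : Finset ι)
    (S : ι → Finset α) (s : ℕ) (hU : U.Nonempty) (hS : ∀ i ∈ J, S i ⊆ U)
    (hs : ∀ i ∈ J, s ≤ (S i).card) :
    ∃ x ∈ U, s * J.card ≤ U.card * (J.filter fun i => x ∈ S i).card := by
  by_contra! h
  have h1 : ∑ x ∈ U, U.card * (J.filter fun i => x ∈ S i).card < ∑ _x ∈ U, s * J.card :=
    Finset.sum_lt_sum_of_nonempty hU h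
  have h2 : ∑ x ∈ U, (J.filter fun i => x ∈ S i).card = ∑ i ∈ J, (S i).card := by
    simp_rw [Finset.card_filter]
    rw [Finset.sum_comm]
    refine Finset.sum_congr rfl fun i hi => ?_
    rw [← Finset.card_filter, Finset.filter_mem_eq_inter,
      Finset.inter_eq_right.2 (hS i hi)]
  have h3 : J.card * s ≤ ∑ i ∈ J, (S i).card := by
    simpa using Finset.card_nsmul_le_sum J (fun i => (S i).card) s hs
  rw [← Finset.mul_sum, h2, Finset.sum_const, smul_eq_mul] at h1
  have h4 := Nat.lt_of_mul_lt_mul_left h1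
  nlinarith

lemma exists_greedy_hitting {α ι : Type*} [DecidableEq α] (U : Finset α) (I : Finset ι)
    (S : ι → Finset α) (s : ℕ) (hU : U.Nonempty) (hS : ∀ i ∈ I, S i ⊆ U)
    (hs : ∀ i ∈ I, s ≤ (S i).card) (k : ℕ) :
    ∃ H ⊆ U, H.card ≤ k ∧ ((I.filter fun i => Disjoint H (S i)).card : ℝ) ≤
      I.card * Real.exp (-((s : ℝ) / U.card * k)) := by
  induction k with
  | zero => exact ⟨∅, by simp, by simp, by simp⟩
  | succ k ih =>
    obtain ⟨H, hHU, hHk, hH⟩ := ih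
    set J := I.filter fun i => Disjoint H (S i) with hJ
    obtain ⟨x, hx, hxJ⟩ := exists_mem_many_sets U J S s hU
      (fun i hi => hS i (Finset.mem_filter.1 hi).1) (fun i hi => hs i (Finset.mem_filter.1 hi).1)
    refine ⟨insert x H, Finset.insert_subset hx hHU,
      (Finset.card_insert_le _ _).trans (by omega), ?_⟩
    have e : (I.filter fun i => Disjoint (insert x H) (S i)) = J.filter fun i => x ∉ S i := by
      ext i
      simp only [hJ, Finset.mem_filter, Finset.disjoint_insert_left]
      tauto
    rw [e]
    have hc := Finset.card_filter_add_card_filter_not (s := J) (fun i => x ∈ S i)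
    have hc' : ((J.filter fun i => x ∈ S i).card : ℝ) + (J.filter fun i => x ∉ S i).card
      = J.card := by exact_mod_cast hc
    have hxJ' : (s : ℝ) * J.card ≤ U.card * (J.filter fun i => x ∈ S i).card := by
      exact_mod_cast hxJ
    have hUpos : (0 : ℝ) < U.card := by exact_mod_cast hU.card_pos
    have h1 : (s : ℝ) / U.card * J.card ≤ (J.filter fun i => x ∈ S i).card := by
      rw [div_mul_eq_mul_div, div_le_iff₀ hUpos]
      linarith
    have h2 : 1 - (s : ℝ) / U.card ≤ Real.exp (-((s : ℝ) / U.card)) := by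
      linarith [Real.add_one_le_exp (-((s : ℝ) / U.card))]
    calc ((J.filter fun i => x ∉ S i).card : ℝ) ≤ J.card * (1 - (s : ℝ) / U.card) := by linarith
      _ ≤ J.card * Real.exp (-((s : ℝ) / U.card)) := by gcongr
      _ ≤ I.card * Real.exp (-((s : ℝ) / U.card * k)) * Real.exp (-((s : ℝ) / U.card)) := by
        gcongr
      _ = _ := by
        rw [mul_assoc, ← Real.exp_add]
        push_cast
        ring_nf

/-- Sets of size at least `s` in a universe of size `m` have a hitting set of size about
`(m / s) * log N`, where `N` is the number of sets. -/
lemma exists_hitting_set {α ι : Type*} [DecidableEq α] (U : Finset α) (I : Finset ι)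
    (S : ι → Finset α) (s : ℕ) (hs0 : 0 < s) (hS : ∀ i ∈ I, S i ⊆ U)
    (hs : ∀ i ∈ I, s ≤ (S i).card) :
    ∃ H ⊆ U, (H.card : ℝ) ≤ (U.card : ℝ) / s * Real.log I.card + 1 ∧
      ∀ i ∈ I, ∃ x ∈ H, x ∈ S i := by
  rcases I.eq_empty_or_nonempty with rfl | ⟨i₀, hi₀⟩
  · exact ⟨∅, by simp, by simp, by simp⟩
  have hU : U.Nonempty := by
    obtain ⟨x, hx⟩ := Finset.card_pos.1 (hs0.trans_le (hs i₀ hi₀))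
    exact ⟨x, hS i₀ hi₀ hx⟩
  have hUpos : (0 : ℝ) < U.card := by exact_mod_cast hU.card_pos
  have hspos : (0 : ℝ) < s := by exact_mod_cast hs0
  have hI : (0 : ℝ) < I.card := by exact_mod_cast Finset.card_pos.2 ⟨i₀, hi₀⟩
  have hlog : 0 ≤ Real.log I.card := Real.log_natCast_nonneg _
  set z := (U.card : ℝ) / s * Real.log I.card with hz
  have hz0 : 0 ≤ z := by positivity
  obtain ⟨H, hHU, hHk, hH⟩ := exists_greedy_hitting U I S s hU hS hs (⌊z⌋₊ + 1)
  refine ⟨H, hHU, ?_, ?_⟩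
  · have : (H.card : ℝ) ≤ (⌊z⌋₊ : ℝ) + 1 := by exact_mod_cast hHk
    linarith [Nat.floor_le hz0]
  · have h1 : Real.log I.card < (s : ℝ) / U.card * ((⌊z⌋₊ + 1 : ℕ) : ℝ) := by
      have h2 : z < ((⌊z⌋₊ + 1 : ℕ) : ℝ) := by
        push_cast
        exact Nat.lt_floor_add_one z
      calc Real.log I.card = (s : ℝ) / U.card * z := by
            rw [hz]
            field_simp
        _ < _ := by gcongr
    have h3 : (I.card : ℝ) * Real.exp (-((s : ℝ) / U.card * ((⌊z⌋₊ + 1 : ℕ) : ℝ))) < 1 := by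
      calc _ < (I.card : ℝ) * Real.exp (-Real.log I.card) := by gcongr
        _ = 1 := by
          rw [Real.exp_neg, Real.exp_log hI]
          field_simp
    have h4 : (I.filter fun i => Disjoint H (S i)).card = 0 := by
      have := hH.trans_lt h3
      exact Nat.lt_one_iff.1 (by exact_mod_cast this)
    intro i hi
    by_contra! hcon
    have : i ∈ I.filter fun i => Disjoint H (S i) :=
      Finset.mem_filter.2 ⟨hi, Finset.disjoint_left.2 hcon⟩
    rw [Finset.card_eq_zero.1 h4] at this
    simp at this

end HittingSet

section Walks

variable {V : Type*} {G G' : Set (V × V)} {u v w : V}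

lemma hasWalk_zero (G : Set (V × V)) (u : V) : hasWalk G u u 0 :=
  ⟨fun _ => u, rfl, rfl, by simp⟩

lemma hasWalk_one (h : (u, v) ∈ G) : hasWalk G u v 1 := by
  refine ⟨fun i => if i = 0 then u else v, by simp, by simp, ?_⟩
  intro i hi
  obtain rfl : i = 0 := by omega
  simpa using h

lemma hasWalk.mono (hG : G ⊆ G') {k : ℕ} (h : hasWalk G u v k) : hasWalk G' u v k := by
  obtain ⟨f, h0, h1, h2⟩ := h
  exact ⟨f, h0, h1, fun i hi => hG (h2 i hi)⟩

lemma hasWalk.append {k l : ℕ} (h : hasWalk G u v k) (h' : hasWalk G v w l) :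
    hasWalk G u w (k + l) := by
  obtain ⟨f, h0, h1, h2⟩ := h
  obtain ⟨g, g0, g1, g2⟩ := h'
  refine ⟨fun i => if i ≤ k then f i else g (i - k), by simpa using h0, ?_, ?_⟩
  · by_cases hl : l = 0
    · subst hl
      simp [h1, ← g1, g0]
    · simp [hl, g1]
  · intro i hi
    rcases lt_trichotomy i k with hik | rfl | hik
    · simpa [hik.le, Nat.succ_le_of_lt hik] using h2 i hik
    · have := g2 0 (by omega)
      simpa [h1, g0] using this
    · have h3 := g2 (i - k) (by omega)
      rw [show i - k + 1 = i + 1 - k by omega] at h3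
      simpa [show ¬ i ≤ k by omega, show ¬ i + 1 ≤ k by omega] using h3

lemma hasWalk_segment {f : ℕ → V} {n : ℕ} (hf : ∀ i < n, (f i, f (i + 1)) ∈ G) {p q : ℕ}
    (hpq : p ≤ q) (hq : q ≤ n) : hasWalk G (f p) (f q) (q - p) :=
  ⟨fun i => f (p + i), by simp, by simp [hpq], fun i hi => hf (p + i) (by omega)⟩

lemma digReach.exists_hasWalk (h : digReach G u v) : ∃ k, hasWalk G u v k := by
  induction h with
  | refl => exact ⟨0, hasWalk_zero G u⟩
  | tail _ h ih =>
    obtain ⟨k, hk⟩ := ih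
    exact ⟨k + 1, hk.append (hasWalk_one h)⟩

lemma hasWalk.transGen {E : Set (V × V)} (hG : G ⊆ digTC E) {k : ℕ} (hk : 0 < k)
    (h : hasWalk G u v k) : Relation.TransGen (digAdj E) u v := by
  obtain ⟨f, rfl, rfl, hf⟩ := h
  induction k with
  | zero => omega
  | succ k ih =>
    have hlast : Relation.TransGen (digAdj E) (f k) (f (k + 1)) := hG (hf k (by omega))
    rcases Nat.eq_zero_or_pos k with rfl | hk'
    · exact hlast
    · exact (ih hk' fun i hi => hf i (by omega)).trans hlast

lemma hasWalk.digReach {E : Set (V × V)} (hG : G ⊆ digTC E) {k : ℕ}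
    (h : hasWalk G u v k) : digReach E u v := by
  rcases Nat.eq_zero_or_pos k with rfl | hk
  · obtain ⟨f, rfl, rfl, -⟩ := h
    exact Relation.ReflTransGen.refl
  · exact (h.transGen hG hk).to_reflTransGen

/-- There is a directed walk of length at most `k` from `u` to `v`. -/
def walkLE (G : Set (V × V)) (k : ℕ) (u v : V) : Prop := ∃ m ≤ k, hasWalk G u v m

lemma walkLE.append {k l : ℕ} (h : walkLE G k u v) (h' : walkLE G l v w) :
    walkLE G (k + l) u w := by
  obtain ⟨m, hm, h⟩ := h
  obtain ⟨m', hm', h'⟩ := h'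
  exact ⟨m + m', by omega, h.append h'⟩

lemma walkLE.mono {k l : ℕ} (hG : G ⊆ G') (hkl : k ≤ l) (h : walkLE G k u v) :
    walkLE G' l u v := by
  obtain ⟨m, hm, h⟩ := h
  exact ⟨m, hm.trans hkl, h.mono hG⟩

lemma walkLE_of_mem_or_eq (h : u = v ∨ (u, v) ∈ G) : walkLE G 1 u v := by
  rcases h with rfl | h
  · exact ⟨0, by omega, hasWalk_zero G u⟩
  · exact ⟨1, le_rfl, hasWalk_one h⟩

lemma walkLE.digDist_le {k : ℕ} (h : walkLE G k u v) : digDist G u v ≤ (k : ℕ∞) := by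
  obtain ⟨m, hm, h⟩ := h
  have h1 : digDist G u v ≤ (m : ℕ∞) := sInf_le ⟨m, h, rfl⟩
  exact h1.trans (by exact_mod_cast hm)

/-- The distance from `u` to `v` is exactly `k`. -/
def distEq (G : Set (V × V)) (k : ℕ) (u v : V) : Prop :=
  hasWalk G u v k ∧ ∀ m, hasWalk G u v m → k ≤ m

lemma digReach.exists_distEq (h : digReach G u v) : ∃ k, distEq G k u v := by
  classical
  exact ⟨Nat.find h.exists_hasWalk, Nat.find_spec h.exists_hasWalk,
    fun m hm => Nat.find_min' _ hm⟩

lemma digReach.mono (hG : G ⊆ G') (h : digReach G u v) : digReach G' u v :=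
  Relation.ReflTransGen.mono (p := digAdj G') (fun _ _ h => hG h) _ _ h

lemma exists_distEq_prefix {E : Set (V × V)} (hE : E ⊆ G) (hG : G ⊆ digTC E) (M : ℕ)
    (h : digReach E u w) :
    walkLE G M u w ∨ ∃ y, distEq G M u y ∧ digReach E y w := by
  obtain ⟨k, ⟨f, rfl, rfl, hf⟩, hmin⟩ := (h.mono hE).exists_distEq
  rcases le_or_gt k M with hk | hk
  · exact Or.inl ⟨k, hk, f, rfl, rfl, hf⟩
  · refine Or.inr ⟨f M, ⟨?_, fun m hm => ?_⟩, (hasWalk_segment hf hk.le le_rfl).digReach hG⟩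
    · simpa using hasWalk_segment hf (Nat.zero_le M) hk.le
    · have := hmin _ (hm.append (hasWalk_segment hf hk.le le_rfl))
      omega

lemma exists_distEq_suffix {E : Set (V × V)} (hE : E ⊆ G) (hG : G ⊆ digTC E) (M : ℕ)
    (h : digReach E w v) :
    walkLE G M w v ∨ ∃ x, distEq G M x v ∧ digReach E w x := by
  obtain ⟨k, ⟨f, rfl, rfl, hf⟩, hmin⟩ := (h.mono hE).exists_distEq
  rcases le_or_gt k M with hk | hk
  · exact Or.inl ⟨k, hk, f, rfl, rfl, hf⟩
  · refine Or.inr ⟨f (k - M), ⟨?_, fun m hm => ?_⟩,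
      (hasWalk_segment hf (Nat.zero_le _) (Nat.sub_le k M)).digReach hG⟩
    · have := hasWalk_segment hf (Nat.sub_le k M) le_rfl
      rwa [show k - (k - M) = M by omega] at this
    · have := hmin _ ((hasWalk_segment hf (Nat.zero_le _) (Nat.sub_le k M)).append hm)
      omega

end Walks

section Chains

variable {V : Type*}

/-- The first `L` values of `d` form a chain for the relation `T`. -/
def IsChainOfLength (T : Set (V × V)) (L : ℕ) (d : ℕ → V) : Prop :=
  ∀ i j, i < j → j < L → (d i, d j) ∈ T

/-- A maximal packing of disjoint chains with `L` vertices. -/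
lemma exists_chain_packing [Fintype V] [Nonempty V] (T : Set (V × V)) (hT : ∀ v, (v, v) ∉ T) {L : ℕ}
    (hL : 0 < L) :
    ∃ (t : ℕ) (c : ℕ → ℕ → V), t * L ≤ Fintype.card V ∧ (∀ a < t, IsChainOfLength T L (c a)) ∧
      ∀ d, IsChainOfLength T L d → ∃ k < L, ∃ a < t, ∃ i < L, d k = c a i := by
  classical
  have hcard : ∀ (t : ℕ) (c : ℕ → ℕ → V),
      (∀ a < t, ∀ i < L, ∀ a' < t, ∀ i' < L, c a i = c a' i' → a = a' ∧ i = i') →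
      t * L ≤ Fintype.card V := by
    intro t c hc
    have h1 := Finset.card_le_card_of_injOn (s := Finset.range t ×ˢ Finset.range L)
      (t := Finset.univ) (fun p => c p.1 p.2) (by simp) (by
        rintro ⟨a, i⟩ h ⟨a', i'⟩ h' he
        simp only [Finset.coe_product, Finset.coe_range, Set.mem_prod, Set.mem_Iio] at h h'
        obtain ⟨rfl, rfl⟩ := hc a h.1 i h.2 a' h'.1 i' h'.2 he
        rfl)
    simpa using h1
  by_contra! hcon
  have key : ∀ t : ℕ, ∃ c : ℕ → ℕ → V, (∀ a < t, IsChainOfLength T L (c a)) ∧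
      ∀ a < t, ∀ i < L, ∀ a' < t, ∀ i' < L, c a i = c a' i' → a = a' ∧ i = i' := by
    intro t
    induction t with
    | zero =>
      exact ⟨fun _ _ => Classical.arbitrary V, by simp, by simp⟩
    | succ t ih =>
      obtain ⟨c, hc, hinj⟩ := ih
      obtain ⟨d, hd, hdc⟩ := hcon t c (hcard t c hinj) hc
      have hdinj : ∀ i < L, ∀ j < L, d i = d j → i = j := by
        intro i hi j hj he
        rcases lt_trichotomy i j with h | h | h
        · exact absurd (hd i j h hj) (by rw [he]; exact hT _)
        · exact h
        · exact absurd (hd j i h hi) (by rw [he]; exact hT _)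
      refine ⟨fun a => if a < t then c a else d, ?_, ?_⟩
      · intro a _
        dsimp only
        split_ifs with h
        exacts [hc a h, hd]
      · intro a ha i hi a' ha' i' hi' he
        dsimp only at he
        split_ifs at he with h h' h'
        · exact hinj a h i hi a' h' i' hi' he
        · exact absurd he.symm (hdc i' hi' a h i hi)
        · exact absurd he (hdc i hi a' h' i' hi')
        · exact ⟨by omega, hdinj i hi i' hi' he⟩
  obtain ⟨c, -, hinj⟩ := key (Fintype.card V + 1)
  have := hcard _ c hinj
  nlinarith

lemma exists_dyadic_separator {i j : ℕ} (h : i < j) : ∃ b, i / 2 ^ b + 1 = j / 2 ^ b := by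
  induction j using Nat.strong_induction_on generalizing i with
  | _ j ih =>
    rcases Nat.lt_or_ge (i / 2) (j / 2) with h' | h'
    · obtain ⟨b, hb⟩ := ih (j / 2) (by omega) h'
      refine ⟨b + 1, ?_⟩
      rwa [pow_succ', ← Nat.div_div_eq_div_mul, ← Nat.div_div_eq_div_mul]
    · exact ⟨0, by simp; omega⟩

/-- The dyadic shortcut edges inside the chains `c a` for `a < t`, using levels `b ≤ ℓ`. -/
def chainShortcuts (c : ℕ → ℕ → V) (t L ℓ : ℕ) : Set (V × V) :=
  {p | ∃ a < t, ∃ i < L, ∃ b < ℓ + 1, p = (c a i, c a ((i / 2 ^ b + 1) * 2 ^ b)) ∨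
    p = (c a (i / 2 ^ b * 2 ^ b), c a i)}

lemma ncard_chainShortcuts_le (c : ℕ → ℕ → V) (t L ℓ : ℕ) :
    (chainShortcuts c t L ℓ).Finite ∧
      (chainShortcuts c t L ℓ).ncard ≤ 2 * (t * L * (ℓ + 1)) := by
  classical
  set B := Finset.range t ×ˢ Finset.range L ×ˢ Finset.range (ℓ + 1)
  have hB : B.card = t * L * (ℓ + 1) := by simp [B, mul_assoc]
  set K := B.image (fun p => (c p.1 p.2.1, c p.1 ((p.2.1 / 2 ^ p.2.2 + 1) * 2 ^ p.2.2))) ∪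
    B.image (fun p => (c p.1 (p.2.1 / 2 ^ p.2.2 * 2 ^ p.2.2), c p.1 p.2.1))
  have hsub : chainShortcuts c t L ℓ ⊆ (K : Set (V × V)) := by
    rintro p ⟨a, ha, i, hi, b, hb, rfl | rfl⟩
    · refine Finset.mem_coe.2 (Finset.mem_union_left _ (Finset.mem_image.2 ⟨(a, i, b), ?_, rfl⟩))
      simp [B, ha, hi]; omega
    · refine Finset.mem_coe.2 (Finset.mem_union_right _ (Finset.mem_image.2 ⟨(a, i, b), ?_, rfl⟩))
      simp [B, ha, hi]; omega
  refine ⟨K.finite_toSet.subset hsub, ?_⟩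
  calc _ ≤ (K : Set (V × V)).ncard := Set.ncard_le_ncard hsub K.finite_toSet
    _ = K.card := Set.ncard_coe_finset K
    _ ≤ B.card + B.card := (Finset.card_union_le _ _).trans
        (add_le_add Finset.card_image_le Finset.card_image_le)
    _ = _ := by rw [hB]; ring

lemma walkLE_two_of_chain {T G : Set (V × V)} {c : ℕ → ℕ → V} {t L ℓ : ℕ} (hL : L < 2 ^ (ℓ + 1))
    (hc : ∀ a < t, IsChainOfLength T L (c a)) (hG : chainShortcuts c t L ℓ ∩ T ⊆ G)
    {a i j : ℕ} (ha : a < t) (hij : i ≤ j) (hj : j < L) : walkLE G 2 (c a i) (c a j) := by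
  rcases hij.eq_or_lt with rfl | hij
  · exact ⟨0, by omega, hasWalk_zero _ _⟩
  obtain ⟨b, hb⟩ := exists_dyadic_separator hij
  have hpos : 0 < 2 ^ b := by positivity
  have hmj : j / 2 ^ b * 2 ^ b ≤ j := Nat.div_mul_le_self _ _
  have him : i < j / 2 ^ b * 2 ^ b := by
    rw [← hb]
    exact (Nat.div_lt_iff_lt_mul hpos).1 (Nat.lt_succ_self _)
  have hbℓ : b < ℓ + 1 := by
    have h1 : 1 ≤ j / 2 ^ b := hb ▸ Nat.le_add_left 1 _
    have h2 : 2 ^ b ≤ j := by nlinarith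
    exact (Nat.pow_lt_pow_iff_right (by norm_num : 1 < 2)).1 (h2.trans_lt (hj.trans hL))
  refine (walkLE_of_mem_or_eq (v := c a (j / 2 ^ b * 2 ^ b)) (Or.inr (hG ⟨?_, ?_⟩))).append
    (k := 1) (l := 1) (walkLE_of_mem_or_eq ?_)
  · exact ⟨a, ha, i, by omega, b, hbℓ, Or.inl (by rw [hb])⟩
  · exact hc a ha _ _ him (by omega)
  · rcases hmj.eq_or_lt with h | h
    · exact Or.inl (by rw [h])
    · exact Or.inr (hG ⟨⟨a, ha, j, hj, b, hbℓ, Or.inr rfl⟩, hc a ha _ _ h hj⟩)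

/-- A long shortest path meets many different chains of a maximal packing. -/
lemma many_chains_of_distEq {E G : Set (V × V)} (hac : digAcyclic E) (hG : G ⊆ digTC E)
    {c : ℕ → ℕ → V} {t L s M : ℕ} (hM : 3 * s + L ≤ M + 1)
    (hc : ∀ a < t, IsChainOfLength (digTC E) L (c a))
    (hmax : ∀ d, IsChainOfLength (digTC E) L d → ∃ k < L, ∃ a < t, ∃ i < L, d k = c a i)
    (htwo : ∀ a < t, ∀ i j, i ≤ j → j < L → walkLE G 2 (c a i) (c a j))
    {x y : V} (h : distEq G M x y) {S : Finset ℕ}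
    (hS : ∀ a < t, ∀ i < L, walkLE G M x (c a i) → walkLE G M (c a i) y → a ∈ S) :
    s ≤ S.card := by
  classical
  obtain ⟨⟨f, rfl, rfl, hf⟩, hmin⟩ := h
  have htc : ∀ p q, p < q → q ≤ M → (f p, f q) ∈ digTC E := fun p q hpq hq =>
    (hasWalk_segment hf hpq.le hq).transGen hG (by omega)
  let on : ℕ → Prop := fun p => ∃ a < t, ∃ i < L, f p = c a i
  set P := Finset.range (M + 1) with hP
  have hsplit := Finset.card_filter_add_card_filter_not (s := P) on
  have hun : (P.filter fun p => ¬ on p).card < L := by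
    by_contra! hge
    obtain ⟨Q, hQ, hQL⟩ := Finset.exists_subset_card_eq hge
    let e := Q.orderEmbOfFin hQL
    have he : ∀ i, e i ∈ Q := fun i => Finset.orderEmbOfFin_mem Q hQL i
    obtain ⟨k, hk, a, ha, i, hi, hki⟩ := hmax
      (fun i => if hi : i < L then f (e ⟨i, hi⟩) else f 0) (by
        intro i j hij hj
        have hi : i < L := by omega
        simp only [hi, hj, dif_pos]
        refine htc _ _ (e.strictMono hij) ?_
        have := (Finset.mem_filter.1 (hQ (he ⟨j, hj⟩))).1
        rw [hP, Finset.mem_range] at this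
        omega)
    simp only [hk, dif_pos] at hki
    exact (Finset.mem_filter.1 (hQ (he ⟨k, hk⟩))).2 ⟨a, ha, i, hi, hki⟩
  have hclose : ∀ a < t, ∀ i < L, ∀ j < L, ∀ p q, p < q → q ≤ M → f p = c a i → f q = c a j →
      q ≤ p + 2 := by
    intro a ha i hi j hj p q hpq hq hp hq'
    rcases le_or_gt i j with hij | hij
    · obtain ⟨m, hm, hw⟩ := htwo a ha i j hij hj
      rw [← hp, ← hq'] at hw
      have := hmin _ (((hasWalk_segment hf (Nat.zero_le p) (by omega)).append hw).append
        (hasWalk_segment hf hq le_rfl))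
      omega
    · have h1 := hc a ha j i hij hi
      have h2 := htc p q hpq hq
      rw [hp, hq'] at h2
      exact absurd (Relation.TransGen.trans h1 h2) (hac _)
  choose! g hg using fun p (hp : on p) => hp
  have himg : ((P.filter on).image g) ⊆ S := by
    intro a ha
    obtain ⟨p, hp, rfl⟩ := Finset.mem_image.1 ha
    obtain ⟨hpP, hon⟩ := Finset.mem_filter.1 hp
    obtain ⟨hgt, i, hi, hfi⟩ := hg p hon
    rw [hP, Finset.mem_range] at hpP
    refine hS _ hgt i hi ?_ ?_
    · rw [← hfi]
      exact ⟨_, by omega, hasWalk_segment hf (Nat.zero_le p) (by omega)⟩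
    · rw [← hfi]
      exact ⟨_, by omega, hasWalk_segment hf (show p ≤ M by omega) le_rfl⟩
  have hfib : ∀ a ∈ (P.filter on).image g, ((P.filter on).filter fun p => g p = a).card ≤ 3 := by
    intro a ha
    set R := (P.filter on).filter fun p => g p = a with hR
    rcases R.eq_empty_or_nonempty with h0 | hne
    · simp [h0]
    have hmem : ∀ p ∈ R, p ≤ M ∧ a < t ∧ ∃ i < L, f p = c a i := by
      intro p hp
      obtain ⟨hp1, rfl⟩ := Finset.mem_filter.1 hp
      obtain ⟨hp2, hon⟩ := Finset.mem_filter.1 hp1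
      rw [hP, Finset.mem_range] at hp2
      exact ⟨by omega, hg p hon⟩
    have hsub : R ⊆ Finset.Icc (R.min' hne) (R.min' hne + 2) := by
      intro q hq
      have hle := R.min'_le q hq
      obtain ⟨-, -, i, hi, hpi⟩ := hmem _ (R.min'_mem hne)
      obtain ⟨hqM, hat, j, hj, hqj⟩ := hmem q hq
      rw [Finset.mem_Icc]
      refine ⟨hle, ?_⟩
      rcases hle.eq_or_lt with h | h
      · omega
      · exact hclose a hat i hi j hj _ q h hqM hpi hqj
    have h3 := Finset.card_le_card hsub
    rw [Nat.card_Icc] at h3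
    omega
  have h1 := Finset.card_le_mul_card_image (P.filter on) 3 hfib
  have h2 := Finset.card_le_card himg
  have h4 : P.card = M + 1 := by simp [hP]
  omega

end Chains

section Connectors

variable {V : Type*}

/-- For every `w ∈ R` and `a ∈ A`, the pairs from `w` to the first vertex of the chain `c a`
that `w` reaches, and from the last vertex of that chain reaching `w` to `w`. -/
noncomputable def chainConnectors (E : Set (V × V)) (c : ℕ → ℕ → V) (L : ℕ) (R : Finset V)
    (A : Finset ℕ) : Set (V × V) :=
  {p | ∃ w ∈ R, ∃ a ∈ A, p = (w, c a (sInf {i | i < L ∧ digReach E w (c a i)})) ∨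
    p = (c a (sSup {i | i < L ∧ digReach E (c a i) w}), w)}

lemma ncard_chainConnectors_le (E : Set (V × V)) (c : ℕ → ℕ → V) (L : ℕ) (R : Finset V)
    (A : Finset ℕ) :
    (chainConnectors E c L R A).Finite ∧
      (chainConnectors E c L R A).ncard ≤ 2 * (R.card * A.card) := by
  classical
  set B := R ×ˢ A
  set K := B.image (fun p => (p.1, c p.2 (sInf {i | i < L ∧ digReach E p.1 (c p.2 i)}))) ∪
    B.image (fun p => (c p.2 (sSup {i | i < L ∧ digReach E (c p.2 i) p.1}), p.1))
  have hsub : chainConnectors E c L R A ⊆ (K : Set (V × V)) := by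
    rintro p ⟨w, hw, a, ha, rfl | rfl⟩
    · exact Finset.mem_coe.2 (Finset.mem_union_left _
        (Finset.mem_image.2 ⟨(w, a), Finset.mk_mem_product hw ha, rfl⟩))
    · exact Finset.mem_coe.2 (Finset.mem_union_right _
        (Finset.mem_image.2 ⟨(w, a), Finset.mk_mem_product hw ha, rfl⟩))
  refine ⟨K.finite_toSet.subset hsub, ?_⟩
  calc _ ≤ (K : Set (V × V)).ncard := Set.ncard_le_ncard hsub K.finite_toSet
    _ = K.card := Set.ncard_coe_finset K
    _ ≤ B.card + B.card := (Finset.card_union_le _ _).trans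
        (add_le_add Finset.card_image_le Finset.card_image_le)
    _ = _ := by rw [Finset.card_product]; ring

lemma digReach.eq_or_mem_digTC {E : Set (V × V)} {u v : V} (h : digReach E u v) :
    u = v ∨ (u, v) ∈ digTC E := by
  rcases Relation.reflTransGen_iff_eq_or_transGen.1 h with h | h
  exacts [Or.inl h.symm, Or.inr h]

lemma walkLE_three_to_chain {E G : Set (V × V)} {c : ℕ → ℕ → V} {L a i : ℕ} {R : Finset V}
    {A : Finset ℕ} {w : V} (hG : chainConnectors E c L R A ∩ digTC E ⊆ G)
    (htwo : ∀ i j, i ≤ j → j < L → walkLE G 2 (c a i) (c a j))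
    (hw : w ∈ R) (ha : a ∈ A) (hi : i < L) (h : digReach E w (c a i)) :
    walkLE G 3 w (c a i) := by
  have hmem := Nat.sInf_mem (s := {i | i < L ∧ digReach E w (c a i)}) ⟨i, hi, h⟩
  have hle := Nat.sInf_le (m := i) (s := {i | i < L ∧ digReach E w (c a i)}) ⟨hi, h⟩
  refine (walkLE_of_mem_or_eq ?_).append (htwo _ _ hle hi)
  exact hmem.2.eq_or_mem_digTC.imp_right fun h' => hG ⟨⟨w, hw, a, ha, Or.inl rfl⟩, h'⟩

lemma walkLE_three_from_chain {E G : Set (V × V)} {c : ℕ → ℕ → V} {L a i : ℕ} {R : Finset V}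
    {A : Finset ℕ} {w : V} (hG : chainConnectors E c L R A ∩ digTC E ⊆ G)
    (htwo : ∀ i j, i ≤ j → j < L → walkLE G 2 (c a i) (c a j))
    (hw : w ∈ R) (ha : a ∈ A) (hi : i < L) (h : digReach E (c a i) w) :
    walkLE G 3 (c a i) w := by
  have hbdd : BddAbove {i | i < L ∧ digReach E (c a i) w} := ⟨L, fun j hj => hj.1.le⟩
  have hmem := Nat.sSup_mem (s := {i | i < L ∧ digReach E (c a i) w}) ⟨i, hi, h⟩ hbdd
  have hle : i ≤ sSup {i | i < L ∧ digReach E (c a i) w} := le_csSup hbdd ⟨hi, h⟩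
  refine (htwo _ _ hle hmem.1).append (walkLE_of_mem_or_eq ?_)
  exact hmem.2.eq_or_mem_digTC.imp_right fun h' => hG ⟨⟨w, hw, a, ha, Or.inr rfl⟩, h'⟩

end Connectors

lemma shortcut_size_bound {n l β D q t ℓ logI logJ R A F : ℝ} (hl : 1 ≤ l) (hn : 2 ≤ n)
    (hβ : 1 ≤ β) (hD : 1 ≤ D) (hq : D ≤ 32 * q) (ht0 : 0 ≤ t) (ht : t * q ≤ n) (hℓ : ℓ ≤ l)
    (hI : logI ≤ 2 * l) (hJ : logJ ≤ 2 * l) (hR0 : 0 ≤ R) (hR : R ≤ n / β * logJ + 1)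
    (hA : A ≤ t / q * logI + 1) (hF : F ≤ 2 * (n * (ℓ + 1)) + 2 * (R * A)) :
    F ≤ 10000 * (n ^ 2 * l ^ 2 / (β * D ^ 2) + n * l) := by
  have hq0 : 0 < q := by linarith
  have hR' : R ≤ 2 * (n * l / β) + 1 := by
    calc R ≤ n / β * logJ + 1 := hR
      _ ≤ n / β * (2 * l) + 1 := by gcongr
      _ = _ := by ring
  have htq : t / q ≤ 1024 * (n / D ^ 2) := by
    have h1 : D ^ 2 ≤ 1024 * q ^ 2 := by nlinarith
    rw [div_le_iff₀ hq0, ← mul_div_assoc, div_mul_eq_mul_div, le_div_iff₀ (by positivity)]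
    calc t * D ^ 2 ≤ t * (1024 * q ^ 2) := by gcongr
      _ = 1024 * (t * q) * q := by ring
      _ ≤ 1024 * n * q := by gcongr
  have hA' : A ≤ 2048 * (n * l / D ^ 2) + 1 := by
    calc A ≤ t / q * logI + 1 := hA
      _ ≤ t / q * (2 * l) + 1 := by gcongr
      _ ≤ 1024 * (n / D ^ 2) * (2 * l) + 1 := by gcongr
      _ = _ := by ring
  have hnl : 1 ≤ n * l := by nlinarith
  have h1 : n * l / β ≤ n * l := div_le_self (by positivity) hβ
  have h2 : n * l / D ^ 2 ≤ n * l := div_le_self (by positivity) (by nlinarith)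
  have h3 : R * A ≤ (2 * (n * l / β) + 1) * (2048 * (n * l / D ^ 2) + 1) := by
    calc R * A ≤ R * (2048 * (n * l / D ^ 2) + 1) := by gcongr
      _ ≤ _ := by gcongr
  have h4 : (2 * (n * l / β) + 1) * (2048 * (n * l / D ^ 2) + 1) =
      4096 * (n ^ 2 * l ^ 2 / (β * D ^ 2)) + 2 * (n * l / β) + 2048 * (n * l / D ^ 2) + 1 := by
    field_simp
    ring
  have h5 : n * (ℓ + 1) ≤ 2 * (n * l) := by nlinarith
  have h6 : 0 ≤ n ^ 2 * l ^ 2 / (β * D ^ 2) := by positivity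
  linarith

/-- There is a universal constant `C` such that every `n`-vertex DAG
(`n ≥ 2`), every `β` with `1 ≤ β ≤ n`, and every integer `D` with
`C·log n ≤ D ≤ n^{0.34}`, admits a set `F ⊆ E^T∖E` of size at most
`C·(n²(log n)²/(βD²) + n·log n)` that `D`-settles every `β`-thick pair. -/
theorem stmt_10 :
    ∃ C : ℝ, 0 < C ∧
      ∀ (V : Type) (_ : Fintype V) (E : Set (V × V)),
        (∀ v : V, (v, v) ∉ E) → digAcyclic E →
        ∀ n : ℕ, Fintype.card V = n → 2 ≤ n →
        ∀ β : ℕ, 1 ≤ β → β ≤ n →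
        ∀ D : ℕ, C * Real.logb 2 n ≤ (D : ℝ) → (D : ℝ) ≤ (n : ℝ) ^ (0.34 : ℝ) →
        ∃ F ⊆ digTC E \ E,
          (F.ncard : ℝ) ≤
            C * ((n : ℝ) ^ 2 * (Real.logb 2 n) ^ 2 / ((β : ℝ) * (D : ℝ) ^ 2) +
              (n : ℝ) * Real.logb 2 n) ∧
          ∀ u v : V, (u, v) ∈ digTC E → β ≤ (digBetween E u v).ncard →
            digDist (E ∪ F) u v ≤ (D : ℕ∞) := by
  classical
  refine ⟨10000, by norm_num, ?_⟩
  intro V _ E _ hac n hn hn2 β hβ hβn D hD hDn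
  have : Nonempty V := Fintype.card_pos_iff.1 (by omega)
  have hn2' : (2 : ℝ) ≤ n := by exact_mod_cast hn2
  have hl : 1 ≤ Real.logb 2 n := by
    rw [Real.le_logb_iff_rpow_le (by norm_num) (by linarith)]
    simpa using hn2'
  have hlogn : Real.log n ≤ Real.logb 2 n := by
    rw [Real.logb, le_div_iff₀ (Real.log_pos (by norm_num))]
    have := Real.log_nonneg (show (1 : ℝ) ≤ n by linarith)
    nlinarith [Real.log_two_lt_d9]
  have hD' : 10000 ≤ D := by
    have : (10000 : ℝ) ≤ D := by linarith
    exact_mod_cast this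
  have hDn' : D ≤ n := by
    have : (D : ℝ) ≤ (n : ℝ) ^ (1 : ℝ) :=
      hDn.trans (Real.rpow_le_rpow_of_exponent_le (by linarith) (by norm_num))
    rw [Real.rpow_one] at this
    exact_mod_cast this
  obtain ⟨q, hq⟩ : ∃ q, q = D / 16 := ⟨_, rfl⟩
  have hq0 : 0 < q := by omega
  have hqn : q < 2 ^ (Nat.log 2 n + 1) :=
    lt_of_le_of_lt (by omega) (Nat.lt_pow_succ_log_self (by norm_num) n)
  obtain ⟨t, c, ht, hc, hmax⟩ := exists_chain_packing (digTC E) hac hq0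
  set F₀ := chainShortcuts c t q (Nat.log 2 n) with hF₀
  set G := E ∪ F₀ ∩ digTC E with hGdef
  have hEG : E ⊆ G := Set.subset_union_left
  have hG : G ⊆ digTC E :=
    Set.union_subset (fun p hp => Relation.TransGen.single hp) Set.inter_subset_right
  have htwo : ∀ a < t, ∀ i j, i ≤ j → j < q → walkLE G 2 (c a i) (c a j) :=
    fun a ha i j hij hj => walkLE_two_of_chain hqn hc Set.subset_union_right ha hij hj
  obtain ⟨A, hAt, hAcard, hA⟩ := exists_hitting_set (Finset.range t)
    (Finset.univ.filter fun p : V × V => distEq G (4 * q) p.1 p.2)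
    (fun p => (Finset.range t).filter fun a =>
      ∃ i < q, walkLE G (4 * q) p.1 (c a i) ∧ walkLE G (4 * q) (c a i) p.2)
    q hq0 (fun p _ => Finset.filter_subset _ _) (fun p hp =>
      many_chains_of_distEq hac hG (by omega) hc hmax htwo (Finset.mem_filter.1 hp).2
        (fun a ha i hi h h' =>
          Finset.mem_filter.2 ⟨Finset.mem_range.2 ha, i, hi, h, h'⟩))
  obtain ⟨R, -, hRcard, hR⟩ := exists_hitting_set (Finset.univ : Finset V)
    (Finset.univ.filter fun p : V × V => β ≤ (digBetween E p.1 p.2).ncard)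
    (fun p => (digBetween E p.1 p.2).toFinset) β hβ (fun p _ => Finset.subset_univ _)
    (fun p hp => by
      rw [← Set.ncard_eq_toFinset_card']
      exact (Finset.mem_filter.1 hp).2)
  set F₁ := chainConnectors E c q R A with hF₁
  have hU : E ∪ ((F₀ ∪ F₁) ∩ digTC E) \ E = G ∪ F₁ ∩ digTC E := by
    rw [Set.union_sdiff_self, hGdef, Set.union_inter_distrib_right, Set.union_assoc]
  refine ⟨((F₀ ∪ F₁) ∩ digTC E) \ E, Set.sdiff_subset_sdiff_left Set.inter_subset_right, ?_, ?_⟩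
  · have hlogI : ∀ J : Finset (V × V), Real.log J.card ≤ 2 * Real.logb 2 n := by
      intro J
      rcases J.eq_empty_or_nonempty with rfl | hJ
      · simp only [Finset.card_empty, Nat.cast_zero, Real.log_zero]
        linarith
      · have h1 : J.card ≤ n ^ 2 := by
          simpa [hn, sq] using Finset.card_le_univ J
        calc Real.log J.card ≤ Real.log ((n : ℝ) ^ 2) :=
              Real.log_le_log (by exact_mod_cast hJ.card_pos) (by exact_mod_cast h1)
          _ = 2 * Real.log n := by rw [Real.log_pow]; norm_num
          _ ≤ _ := by linarith
    obtain ⟨hf₀, hc₀⟩ := ncard_chainShortcuts_le c t q (Nat.log 2 n)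
    obtain ⟨hf₁, hc₁⟩ := ncard_chainConnectors_le E c q R A
    rw [hn] at ht
    have hF : (((F₀ ∪ F₁) ∩ digTC E) \ E).ncard ≤
        2 * (n * (Nat.log 2 n + 1)) + 2 * (R.card * A.card) :=
      calc _ ≤ (F₀ ∪ F₁).ncard := Set.ncard_le_ncard
              (Set.sdiff_subset.trans Set.inter_subset_left) (hf₀.union hf₁)
        _ ≤ F₀.ncard + F₁.ncard := Set.ncard_union_le _ _
        _ ≤ 2 * (t * q * (Nat.log 2 n + 1)) + 2 * (R.card * A.card) := add_le_add hc₀ hc₁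
        _ ≤ _ := by gcongr
    rw [Finset.card_range] at hAcard
    rw [Finset.card_univ, hn] at hRcard
    refine shortcut_size_bound hl hn2' (by exact_mod_cast hβ) (by linarith)
      (q := q) (t := t) ?_ (by positivity) (by exact_mod_cast ht) (ℓ := (Nat.log 2 n : ℕ)) ?_
      (hlogI _) (hlogI _) (by positivity) hRcard hAcard (by exact_mod_cast hF)
    · have : D ≤ 32 * q := by omega
      exact_mod_cast this
    · exact_mod_cast Real.natLog_le_logb n 2
  · intro u v huv hthick
    rw [hU]
    obtain ⟨w, hwR, hw⟩ := hR (u, v) (Finset.mem_filter.2 ⟨Finset.mem_univ _, hthick⟩)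
    obtain ⟨huw, hwv⟩ : digReach E u w ∧ digReach E w v :=
      (Set.mem_toFinset (s := digBetween E u v)).1 hw
    have hGH : G ⊆ G ∪ F₁ ∩ digTC E := Set.subset_union_left
    have hFH : F₁ ∩ digTC E ⊆ G ∪ F₁ ∩ digTC E := Set.subset_union_right
    have h1 : walkLE (G ∪ F₁ ∩ digTC E) (4 * q + 3) u w := by
      rcases exists_distEq_prefix hEG hG (4 * q) huw with h | ⟨y, huy, hyw⟩
      · exact h.mono hGH (by omega)
      · obtain ⟨a, haA, ha⟩ := hA (u, y) (Finset.mem_filter.2 ⟨Finset.mem_univ _, huy⟩)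
        obtain ⟨hat, i, hi, hui, m, -, hiy⟩ := Finset.mem_filter.1 ha
        exact (hui.mono hGH le_rfl).append (walkLE_three_from_chain hFH
          (fun i j hij hj => (htwo a (Finset.mem_range.1 hat) i j hij hj).mono hGH le_rfl)
          hwR haA hi ((hiy.digReach hG).trans hyw))
    have h2 : walkLE (G ∪ F₁ ∩ digTC E) (3 + 4 * q) w v := by
      rcases exists_distEq_suffix hEG hG (4 * q) hwv with h | ⟨x, hxv, hwx⟩
      · exact h.mono hGH (by omega)
      · obtain ⟨a, haA, ha⟩ := hA (x, v) (Finset.mem_filter.2 ⟨Finset.mem_univ _, hxv⟩)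
        obtain ⟨hat, i, hi, ⟨m, -, hxi⟩, hiv⟩ := Finset.mem_filter.1 ha
        exact (walkLE_three_to_chain hFH
          (fun i j hij hj => (htwo a (Finset.mem_range.1 hat) i j hij hj).mono hGH le_rfl)
          hwR haA hi (hwx.trans (hxi.digReach hG))).append (hiv.mono hGH le_rfl)
    exact ((h1.append h2).mono subset_rfl (by omega)).digDist_le
end
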